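/- Let X ⊂ ℙ^{17} be an 11-dimensional nondegenerate smooth complex projective quadratic variety of Fano index 8 which is covered by lines and such that, for a general point x ∈ X, the Hilbert scheme of lines L_x ⊂ ℙ((T_xX)^∨) = ℙ^{10} is projectively equivalent to a Gushel–Mukai 6-fold. Then there does not exist a double cover f : X → Y onto a smooth quadratic variety Y ⊂ ℙ^{16}. -/

import Mathlib

/-!
Common framework for formalizing "Quadratic Varieties of Small Codimension"
(K. Watanabe), following Ionescu–Russo.

We model a projective variety as a subset of the complex projective space
`PS m := ℙ ℂ (Fin m → ℂ)` (which is `ℙ^{m-1}`, with `m` homogeneous coordinates).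
-/

noncomputable section

open scoped BigOperators

/-- Complex projective space `ℙ^{m-1}`, described by `m` homogeneous coordinates. -/
abbrev PS (m : ℕ) : Type := Projectivization ℂ (Fin m → ℂ)

namespace PaperQV

/-- A polynomial vanishes at a point of projective space, i.e. on the whole
corresponding line in affine space. -/
def PVanish {m : ℕ} (p : MvPolynomial (Fin m) ℂ) (x : PS m) : Prop :=
  ∀ v ∈ x.submodule, MvPolynomial.eval v p = 0

/-- The common zero locus, in projective space, of a set of polynomials. -/
def ZeroLocus {m : ℕ} (P : Set (MvPolynomial (Fin m) ℂ)) : Set (PS m) :=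
  {x | ∀ p ∈ P, PVanish p x}

/-- Zariski-closed subsets of projective space. -/
def ZClosed {m : ℕ} (S : Set (PS m)) : Prop :=
  ∃ P : Set (MvPolynomial (Fin m) ℂ), S = ZeroLocus P

/-- Zariski closure. -/
def ZClosure {m : ℕ} (S : Set (PS m)) : Set (PS m) :=
  ⋂₀ {C | ZClosed C ∧ S ⊆ C}

/-- Irreducibility with respect to the Zariski topology. -/
def ZIrreducible {m : ℕ} (S : Set (PS m)) : Prop :=
  S.Nonempty ∧ ∀ C₁ C₂ : Set (PS m), ZClosed C₁ → ZClosed C₂ → S ⊆ C₁ ∪ C₂ →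
    S ⊆ C₁ ∨ S ⊆ C₂

/-- `X` contains a strictly increasing chain of `n + 1` irreducible Zariski-closed
subsets, i.e. `dim X ≥ n`. -/
def DimGE {m : ℕ} (X : Set (PS m)) (n : ℕ) : Prop :=
  ∃ c : Fin (n + 1) → Set (PS m),
    StrictMono c ∧ ∀ i, ZClosed (c i) ∧ ZIrreducible (c i) ∧ c i ⊆ X

/-- `X` has dimension exactly `n`. -/
def HasDim {m : ℕ} (X : Set (PS m)) (n : ℕ) : Prop :=
  DimGE X n ∧ ¬ DimGE X (n + 1)

/-- The differential of a polynomial `p` at the vector `v`, as a linear functional. -/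
def polyDiff {m : ℕ} (p : MvPolynomial (Fin m) ℂ) (v : Fin m → ℂ) :
    (Fin m → ℂ) →ₗ[ℂ] ℂ :=
  ∑ j, MvPolynomial.eval v (MvPolynomial.pderiv j p) • LinearMap.proj j

/-- The Zariski tangent space at `x ∈ X` of the affine cone over `X`:
the intersection of the kernels of the differentials at `x.rep` of all
polynomials vanishing on `X`. -/
def tangentSubmodule {m : ℕ} (X : Set (PS m)) (x : PS m) :
    Submodule ℂ (Fin m → ℂ) :=
  ⨅ (p : MvPolynomial (Fin m) ℂ) (_ : ∀ y ∈ X, PVanish p y),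
    LinearMap.ker (polyDiff p x.rep)

/-- `X ⊆ ℙ^{m-1}` is a smooth projective variety of dimension `n`:
it is Zariski closed, irreducible, of dimension `n`, and at every point the
Zariski tangent space of its affine cone has dimension `n + 1`. -/
def SmoothVariety {m : ℕ} (X : Set (PS m)) (n : ℕ) : Prop :=
  ZClosed X ∧ ZIrreducible X ∧ HasDim X n ∧
    ∀ x ∈ X, Module.finrank ℂ (tangentSubmodule X x) = n + 1

/-- `X` is nondegenerate: it is contained in no hyperplane. -/
def Nondegenerate {m : ℕ} (X : Set (PS m)) : Prop :=
  ∀ φ : (Fin m → ℂ) →ₗ[ℂ] ℂ, (∀ x ∈ X, ∀ v ∈ x.submodule, φ v = 0) → φ = 0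

/-- The hypersurfaces `Q i = 0` cut out `X` scheme-theoretically: `X` is their
set-theoretic intersection, and at every point of `X` the `Q i` realize the full
Zariski tangent space (i.e. their differentials span the conormal space, so they
generate the ideal sheaf of the smooth variety `X`). -/
def SchemeCutOutBy {m k : ℕ} (X : Set (PS m)) (Q : Fin k → MvPolynomial (Fin m) ℂ) : Prop :=
  X = {x | ∀ i, PVanish (Q i) x} ∧
    ∀ x ∈ X, ∀ p : MvPolynomial (Fin m) ℂ, (∀ y ∈ X, PVanish p y) →
      (⨅ i, LinearMap.ker (polyDiff (Q i) x.rep)) ≤ LinearMap.ker (polyDiff p x.rep)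

/-- `X` is scheme-theoretically defined by `c` (linearly) independent quadratic equations. -/
def CutOutByQuadrics {m : ℕ} (X : Set (PS m)) (c : ℕ) : Prop :=
  ∃ Q : Fin c → MvPolynomial (Fin m) ℂ,
    (∀ i, (Q i).IsHomogeneous 2) ∧ LinearIndependent ℂ Q ∧ SchemeCutOutBy X Q

/-- A quadratic variety: scheme-theoretically an intersection of quadrics. -/
def IsQuadratic {m : ℕ} (X : Set (PS m)) : Prop :=
  ∃ c : ℕ, CutOutByQuadrics X c

/-- `X ⊆ ℙ^{m-1}` of dimension `n` is a complete intersection: it is cut out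
scheme-theoretically by exactly `codim X = (m - 1) - n` hypersurfaces. -/
def IsCompleteIntersection {m : ℕ} (X : Set (PS m)) (n : ℕ) : Prop :=
  ∃ F : Fin (m - 1 - n) → MvPolynomial (Fin m) ℂ, ∃ d : Fin (m - 1 - n) → ℕ,
    (∀ i, (F i).IsHomogeneous (d i)) ∧ (∀ i, 1 ≤ d i) ∧ SchemeCutOutBy X F

/-- Lines in projective space: projectivizations of 2-dimensional subspaces. -/
def IsLine {m : ℕ} (L : Set (PS m)) : Prop :=
  ∃ W : Submodule ℂ (Fin m → ℂ), Module.finrank ℂ W = 2 ∧ L = {x | x.submodule ≤ W}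

/-- `X` is covered by lines. -/
def CoveredByLines {m : ℕ} (X : Set (PS m)) : Prop :=
  ∀ x ∈ X, ∃ L : Set (PS m), IsLine L ∧ x ∈ L ∧ L ⊆ X

/-- `X` and `Y` are projectively equivalent (via a linear isomorphism of the
ambient homogeneous coordinate spaces). -/
def ProjEquiv {m₁ m₂ : ℕ} (X : Set (PS m₁)) (Y : Set (PS m₂)) : Prop :=
  ∃ (f : (Fin m₁ → ℂ) →ₗ[ℂ] (Fin m₂ → ℂ)) (hf : Function.Injective f),
    Function.Surjective f ∧ Projectivization.map f hf '' X = Y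

/-- `X ⊆ ℙ^{m₁-1}` is projectively equivalent to a hyperplane section of
`S ⊆ ℙ^{m₂-1}`: a linear embedding of the ambient space of `X` onto a hyperplane
carries `X` onto the corresponding hyperplane section of `S`. -/
def ProjEquivToHyperplaneSection {m₁ m₂ : ℕ} (X : Set (PS m₁)) (S : Set (PS m₂)) : Prop :=
  ∃ (f : (Fin m₁ → ℂ) →ₗ[ℂ] (Fin m₂ → ℂ)) (hf : Function.Injective f),
    Module.finrank ℂ (LinearMap.range f) + 1 = m₂ ∧
    Projectivization.map f hf '' X = S ∩ {y | y.submodule ≤ LinearMap.range f}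

/-! ### Explicit varieties: the Segre 3-fold, the Grassmannian `G(2,ℂ⁵)`,
the 10-dimensional spinor variety, cones, and Gushel–Mukai 6-folds. -/

/-- Index bookkeeping for the Segre embedding `ℙ¹ × ℙ² → ℙ⁵`. -/
def segreIdx : Fin 6 → Fin 2 × Fin 3 :=
  ![(0, 0), (0, 1), (0, 2), (1, 0), (1, 1), (1, 2)]

/-- The Segre coordinates of a pair of vectors. -/
def segreVec (a : Fin 2 → ℂ) (b : Fin 3 → ℂ) : Fin 6 → ℂ :=
  fun k => a (segreIdx k).1 * b (segreIdx k).2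

/-- The Segre 3-fold `ℙ¹ × ℙ² ⊆ ℙ⁵`. -/
def Segre12 : Set (PS 6) :=
  {x | ∃ (a : Fin 2 → ℂ) (b : Fin 3 → ℂ) (hv : segreVec a b ≠ 0),
    x = Projectivization.mk ℂ (segreVec a b) hv}

/-- The pairs `i < j` in `Fin 5`, indexing Plücker coordinates. -/
def pluckerPair : Fin 10 → Fin 5 × Fin 5 :=
  ![(0, 1), (0, 2), (0, 3), (0, 4), (1, 2), (1, 3), (1, 4), (2, 3), (2, 4), (3, 4)]

/-- The Plücker coordinates of the 2-plane spanned by `a`, `b` in `ℂ⁵`. -/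
def pluckerVec (a b : Fin 5 → ℂ) : Fin 10 → ℂ :=
  fun k => a (pluckerPair k).1 * b (pluckerPair k).2
    - a (pluckerPair k).2 * b (pluckerPair k).1

/-- The Grassmannian `G(2, ℂ⁵) ⊆ ℙ⁹` in its Plücker embedding. -/
def Grass25 : Set (PS 10) :=
  {x | ∃ (a b : Fin 5 → ℂ) (hv : pluckerVec a b ≠ 0),
    x = Projectivization.mk ℂ (pluckerVec a b) hv}

/-- `pfc i` lists the four elements of `Fin 5 \ {i}`, in increasing order. -/
def pfc : Fin 5 → Fin 4 → Fin 5 :=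
  ![![1, 2, 3, 4], ![0, 2, 3, 4], ![0, 1, 3, 4], ![0, 1, 2, 4], ![0, 1, 2, 3]]

/-- The sub-Pfaffian of a (skew-symmetric) `5 × 5` matrix obtained by deleting
the `i`-th row and column. -/
def subPfaffian (A : Fin 5 → Fin 5 → ℂ) (i : Fin 5) : ℂ :=
  A (pfc i 0) (pfc i 1) * A (pfc i 2) (pfc i 3)
    - A (pfc i 0) (pfc i 2) * A (pfc i 1) (pfc i 3)
    + A (pfc i 0) (pfc i 3) * A (pfc i 1) (pfc i 2)

/-- The spinor coordinates `(1, (a_{ij})_{i<j}, (Pf_i(A))_i)` of a skew-symmetric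
`5 × 5` matrix: the affine parametrization of the spinor embedding. -/
def spinorTail (A : Fin 5 → Fin 5 → ℂ) : Fin 15 → ℂ :=
  (Fin.append (fun t : Fin 10 => A (pluckerPair t).1 (pluckerPair t).2)
    (subPfaffian A) : Fin (10 + 5) → ℂ)

def spinorVec (A : Fin 5 → Fin 5 → ℂ) : Fin 16 → ℂ :=
  fun k =>
    (Fin.cons (1 : ℂ) (spinorTail A) : Fin (15 + 1) → ℂ)
      (Fin.cast (show (16 : ℕ) = 15 + 1 by norm_num) k)

/-- The 10-dimensional spinor variety `S^{10} ⊆ ℙ^{15}`: the Zariski closure of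
the image of the space of skew-symmetric `5 × 5` matrices under the
sub-Pfaffian (spinor) parametrization. -/
def Spinor10 : Set (PS 16) :=
  ZClosure {x | ∃ A : Fin 5 → Fin 5 → ℂ, (∀ i j, A j i = - A i j) ∧
    ∃ hv : spinorVec A ≠ 0, x = Projectivization.mk ℂ (spinorVec A) hv}

/-- The cone with vertex `o` over a subset `Y` of projective space. -/
def ConeOver {m : ℕ} (o : PS m) (Y : Set (PS m)) : Set (PS m) :=
  {z | z = o ∨ ∃ y ∈ Y, z.submodule ≤ o.submodule ⊔ y.submodule}

/-- Gushel–Mukai 6-folds `Σ^6_{10} ⊆ ℙ^{10}`: smooth 6-dimensional sections of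
the cone over the Plücker-embedded `G(2,ℂ⁵) ⊆ ℙ⁹ ⊆ ℙ^{10}` by a smooth quadric
hypersurface. -/
def IsGushelMukai6 (W : Set (PS 11)) : Prop :=
  ∃ (f : (Fin 10 → ℂ) →ₗ[ℂ] (Fin 11 → ℂ)) (hf : Function.Injective f)
    (o : PS 11) (q : MvPolynomial (Fin 11) ℂ),
    ¬ o.submodule ≤ LinearMap.range f ∧
    q.IsHomogeneous 2 ∧
    (∀ v : Fin 11 → ℂ, MvPolynomial.eval v q = 0 →
      (∀ j, MvPolynomial.eval v (MvPolynomial.pderiv j q) = 0) → v = 0) ∧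
    W = ConeOver o (Projectivization.map f hf '' Grass25) ∩ {x | PVanish q x} ∧
    SmoothVariety W 6

/-! ### Lines through a point, the Hilbert scheme of lines `L_x`, general points. -/

/-- The line through `x` with direction vector `v` (the projectivization of the
span of `x` and `v`). -/
def LineThrough {m : ℕ} (x : PS m) (v : Fin m → ℂ) : Set (PS m) :=
  {y | y.submodule ≤ x.submodule ⊔ Submodule.span ℂ {v}}

/-- `W ⊆ ℙ^{n-1} = ℙ(T_x X)` is a model, via the tangent map, of the Hilbert
scheme `L_x` of lines on `X` through `x`:  a linear identification `j` of `ℂⁿ`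
with a complement of the line `x̂` inside the (affine cone) tangent space of `X`
at `x` carries `W` onto the set of tangent directions of lines on `X` through `x`. -/
def IsVMRTModel {m n : ℕ} (X : Set (PS m)) (x : PS m) (W : Set (PS n)) : Prop :=
  ∃ j : (Fin n → ℂ) →ₗ[ℂ] (Fin m → ℂ), Function.Injective j ∧
    LinearMap.range j ⊓ x.submodule = ⊥ ∧
    LinearMap.range j ⊔ x.submodule = tangentSubmodule X x ∧
    W = {u : PS n | LineThrough x (j u.rep) ⊆ X}

/-- `P` holds at all points of `X` off some proper Zariski-closed subset,
i.e. at a general point of `X`. -/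
def GenericallyOn {m : ℕ} (X : Set (PS m)) (P : PS m → Prop) : Prop :=
  ∃ C : Set (PS m), ZClosed C ∧ ¬ X ⊆ C ∧ ∀ x ∈ X \ C, P x

/-- The locus swept out by the lines on `X` through `x`. -/
def LocusOfLines {m : ℕ} (X : Set (PS m)) (x : PS m) : Set (PS m) :=
  ⋃₀ {L | IsLine L ∧ x ∈ L ∧ L ⊆ X}

/-! ### Products, morphisms, double covers, conics. -/

/-- Zariski-closed subsets of a product of projective spaces (cut out by
multihomogeneous polynomials in the two groups of variables). -/
def ZClosedProd {m₁ m₂ : ℕ} (S : Set (PS m₁ × PS m₂)) : Prop :=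
  ∃ P : Set (MvPolynomial (Fin m₁ ⊕ Fin m₂) ℂ),
    S = {z | ∀ p ∈ P, ∀ v ∈ z.1.submodule, ∀ w ∈ z.2.submodule,
      MvPolynomial.eval (Sum.elim v w) p = 0}

/-- `f` restricts to a morphism of projective varieties `X → Y`
(its graph over `X` is Zariski closed). -/
def IsMorphismOn {m₁ m₂ : ℕ} (X : Set (PS m₁)) (Y : Set (PS m₂))
    (f : PS m₁ → PS m₂) : Prop :=
  Set.MapsTo f X Y ∧ ZClosedProd {z : PS m₁ × PS m₂ | z.1 ∈ X ∧ z.2 = f z.1}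

/-- A double cover `X → Y`: a finite surjective morphism of degree `2`. -/
def IsDoubleCover {m₁ m₂ : ℕ} (X : Set (PS m₁)) (Y : Set (PS m₂))
    (f : PS m₁ → PS m₂) : Prop :=
  IsMorphismOn X Y f ∧ Set.SurjOn f X Y ∧
    (∀ y ∈ Y, {x | x ∈ X ∧ f x = y}.Finite) ∧
    GenericallyOn Y (fun y => {x | x ∈ X ∧ f x = y}.ncard = 2)

/-- Irreducible conics: irreducible plane sections of quadrics that are neither
lines nor full planes. -/
def IsIrreducibleConic {m : ℕ} (C : Set (PS m)) : Prop :=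
  ∃ (W : Submodule ℂ (Fin m → ℂ)) (q : MvPolynomial (Fin m) ℂ),
    Module.finrank ℂ W = 3 ∧ q.IsHomogeneous 2 ∧
    C = {x | x.submodule ≤ W ∧ PVanish q x} ∧
    ZIrreducible C ∧ ¬ IsLine C ∧ C ≠ {x | x.submodule ≤ W}

/-- "P holds for two general points of X." -/
def GenericallyOnPairs {m : ℕ} (X : Set (PS m)) (P : PS m → PS m → Prop) : Prop :=
  ∃ B : Set (PS m × PS m), ZClosedProd B ∧ ¬ X ×ˢ X ⊆ B ∧
    ∀ x ∈ X, ∀ y ∈ X, (x, y) ∉ B → P x y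

/-- `X` is conic-connected: through two general points of `X` there passes an
irreducible conic contained in `X`. -/
def ConicConnected {m : ℕ} (X : Set (PS m)) : Prop :=
  GenericallyOnPairs X fun x y =>
    ∃ C : Set (PS m), IsIrreducibleConic C ∧ C ⊆ X ∧ x ∈ C ∧ y ∈ C

/-- An interpretation of the transcendental / cohomological invariants of
embedded projective varieties used in the paper: being Fano, the Fano index,
`Pic ≅ ℤ`, degrees of normal bundles of lines, the degree, and conditions on
`H²`, `H⁴`, Chern classes and the second Chern character. -/
structure GeomInterp where
  /-- `X` is a Fano variety. -/
  IsFanoVariety : ∀ {m : ℕ}, Set (PS m) → Prop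
  /-- The Fano index of `X`: the maximal `r` such that `r` divides `-K_X` in `Pic X`. -/
  fanoIndex : ∀ {m : ℕ}, Set (PS m) → ℕ
  /-- `Pic X ≅ ℤ`. -/
  PicIsZ : ∀ {m : ℕ}, Set (PS m) → Prop
  /-- `deg N_{ℓ/X}`, the degree of the normal bundle of a line `ℓ ⊆ X`. -/
  normalBundleDeg : ∀ {m : ℕ}, Set (PS m) → Set (PS m) → ℤ
  /-- The degree of `X`, i.e. the self-intersection number `H^{dim X}`. -/
  degreeOf : ∀ {m : ℕ}, Set (PS m) → ℕ
  /-- `H²(X, ℤ) ≅ ℤ[H]`, generated by the hyperplane class. -/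
  H2GenByHyperplane : ∀ {m : ℕ}, Set (PS m) → Prop
  /-- `H⁴(X, ℤ) ≅ ℤ[H²]`. -/
  H4GenByHyperplaneSq : ∀ {m : ℕ}, Set (PS m) → Prop
  /-- `c₁(X) = a·H` in `H²(X, ℤ)`. -/
  c1Eq : ∀ {m : ℕ}, Set (PS m) → ℤ → Prop
  /-- `c₂(X) = a·H²` in `H⁴(X, ℤ)`. -/
  c2Eq : ∀ {m : ℕ}, Set (PS m) → ℤ → Prop
  /-- `ch₂(X) = (c₁(X)² - 2c₂(X))/2 = a·H²` in `H⁴(X, ℤ)`. -/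
  ch2Eq : ∀ {m : ℕ}, Set (PS m) → ℤ → Prop

end PaperQV

open PaperQV

section Basics

theorem hasDerivAt_eval_comp {m : ℕ} (p : MvPolynomial (Fin m) ℂ) {γ : ℂ → Fin m → ℂ}
    {γ' : Fin m → ℂ} {s : ℂ} (hγ : ∀ i, HasDerivAt (fun s => γ s i) (γ' i) s) :
    HasDerivAt (fun s => MvPolynomial.eval (γ s) p) (polyDiff p (γ s) γ') s := by
  induction p using MvPolynomial.induction_on with
  | C a =>
    have : polyDiff (MvPolynomial.C a) (γ s) = 0 := by simp [polyDiff]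
    rw [this]
    simpa using hasDerivAt_const s a
  | add p q hp hq =>
    have : polyDiff (p + q) (γ s) = polyDiff p (γ s) + polyDiff q (γ s) := by
      simp [polyDiff, add_smul, Finset.sum_add_distrib]
    rw [this]
    simp only [map_add, LinearMap.add_apply]
    exact hp.fun_add hq
  | mul_X p i hp =>
    have h := hp.fun_mul (hγ i)
    simp only [map_mul, MvPolynomial.eval_X]
    refine h.congr_deriv ?_
    simp [polyDiff, Derivation.leibniz, MvPolynomial.pderiv_X, add_mul,
      Finset.sum_add_distrib, Finset.sum_mul, Pi.single_apply, apply_ite]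
    rw [add_comm]
    congr 1
    exact Finset.sum_congr rfl fun j _ => by ring

/-- A homogeneous quadratic polynomial is the diagonal of a symmetric bilinear form. -/
theorem exists_bilin_of_isHomogeneous_two {m : ℕ} (p : MvPolynomial (Fin m) ℂ)
    (hp : p.IsHomogeneous 2) :
    ∃ B : (Fin m → ℂ) →ₗ[ℂ] (Fin m → ℂ) →ₗ[ℂ] ℂ, (∀ v w, B v w = B w v) ∧
      ∀ v, MvPolynomial.eval v p = B v v := by
  classical
  have key : ∀ d : Fin m →₀ ℕ, d.degree = 2 → ∃ B : (Fin m → ℂ) →ₗ[ℂ] (Fin m → ℂ) →ₗ[ℂ] ℂ,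
      (∀ v w, B v w = B w v) ∧ ∀ v, (d.prod fun i e => v i ^ e) = B v v := by
    intro d hd
    obtain ⟨i, hi⟩ : ∃ i, d i ≠ 0 := by
      by_contra! h
      have : d = 0 := Finsupp.ext h
      simp [this] at hd
    have h1 : d = Finsupp.single i 1 + (d - Finsupp.single i 1) := by
      ext k
      by_cases hk : k = i
      · subst hk; simp; omega
      · simp [Ne.symm hk]
    set d' := d - Finsupp.single i 1
    have hd' : d'.degree = 1 := by
      rw [h1, map_add, Finsupp.degree_single] at hd; omega
    obtain ⟨j, hj⟩ : ∃ j, Finsupp.single j 1 = d' := by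
      have h : d' ∈ {d : Fin m →₀ ℕ | d.degree = 1} := hd'
      rwa [← Finsupp.range_single_one] at h
    let P : (Fin m → ℂ) →ₗ[ℂ] (Fin m → ℂ) →ₗ[ℂ] ℂ :=
      (LinearMap.mul ℂ ℂ).compl₁₂ (LinearMap.proj i) (LinearMap.proj j)
    refine ⟨(1 / 2 : ℂ) • (P + P.flip), fun v w => ?_, fun v => ?_⟩
    · simp [P]; ring
    · rw [h1, ← hj, Finsupp.prod_add_index' (by simp) (by intros; ring)]
      simp [P]; ring
  choose! B hB using key
  have hdeg : ∀ d ∈ p.support, d.degree = 2 := fun d hd => by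
    by_contra h
    exact MvPolynomial.mem_support_iff.1 hd (hp.coeff_eq_zero h)
  refine ⟨∑ d ∈ p.support, p.coeff d • B d, fun v w => ?_, fun v => ?_⟩
  · simp only [LinearMap.sum_apply, LinearMap.smul_apply]
    refine Finset.sum_congr rfl fun d hd => ?_
    rw [(hB d (hdeg d hd)).1]
  · rw [MvPolynomial.eval_eq']
    simp only [LinearMap.sum_apply, LinearMap.smul_apply]
    refine Finset.sum_congr rfl fun d hd => ?_
    rw [← (hB d (hdeg d hd)).2, Finsupp.prod_fintype _ _ (by simp), smul_eq_mul]

theorem polyDiff_apply_of_eval_eq {m : ℕ} {p : MvPolynomial (Fin m) ℂ}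
    {B : (Fin m → ℂ) →ₗ[ℂ] (Fin m → ℂ) →ₗ[ℂ] ℂ} (hs : ∀ v w, B v w = B w v)
    (hB : ∀ v, MvPolynomial.eval v p = B v v) (v w : Fin m → ℂ) :
    polyDiff p v w = 2 * B v w := by
  have h1 : HasDerivAt (fun s : ℂ => MvPolynomial.eval (v + s • w) p) (polyDiff p v w) 0 := by
    have := hasDerivAt_eval_comp p (γ := fun s : ℂ => v + s • w) (γ' := w) (s := 0) fun i => by
      simpa using ((hasDerivAt_id (0 : ℂ)).mul_const (w i)).const_add (v i)
    simpa using this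
  have h2 : HasDerivAt (fun s : ℂ => MvPolynomial.eval (v + s • w) p) (2 * B v w) 0 := by
    have : (fun s : ℂ => MvPolynomial.eval (v + s • w) p)
        = fun s => B v v + s * (2 * B v w) + s ^ 2 * B w w := by
      funext s
      rw [hB]
      simp [hs w v]
      ring
    rw [this]
    have := (((hasDerivAt_id (0 : ℂ)).mul_const (2 * B v w)).const_add (B v v)).fun_add
      (((hasDerivAt_id (0 : ℂ)).fun_pow 2).mul_const (B w w))
    simpa using this
  exact h1.unique h2

theorem polyDiff_apply_eq_sum {m : ℕ} (p : MvPolynomial (Fin m) ℂ) (v w : Fin m → ℂ) :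
    polyDiff p v w = ∑ j, MvPolynomial.eval v (MvPolynomial.pderiv j p) * w j := by
  simp [polyDiff]

theorem pvanish_of_forall_smul {m : ℕ} {p : MvPolynomial (Fin m) ℂ} {x : PS m}
    (h : ∀ c : ℂ, MvPolynomial.eval (c • x.rep) p = 0) : PVanish p x := by
  intro v hv
  rw [Projectivization.submodule_eq] at hv
  obtain ⟨c, rfl⟩ := Submodule.mem_span_singleton.1 hv
  exact h c

theorem rep_mem_submodule {m : ℕ} (x : PS m) : x.rep ∈ x.submodule := by
  rw [Projectivization.submodule_eq]; exact Submodule.mem_span_singleton_self _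

/-- A quadratic system valued in `K`: `X` is the zero set of `v ↦ D v v` and the affine
tangent space at `x` is the kernel of `D x.rep`. -/
theorem PaperQV.IsQuadratic.exists_system {m : ℕ} {X : Set (PS m)} (h : IsQuadratic X) :
    ∃ (c : ℕ) (D : (Fin m → ℂ) →ₗ[ℂ] (Fin m → ℂ) →ₗ[ℂ] (Fin c → ℂ)),
      (∀ v w, D v w = D w v) ∧ (∀ x : PS m, x ∈ X ↔ D x.rep x.rep = 0) ∧
      ∀ x ∈ X, tangentSubmodule X x = LinearMap.ker (D x.rep) := by
  obtain ⟨c, Q, hQ, -, hX, hT⟩ := h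
  choose B hs hB using fun i => exists_bilin_of_isHomogeneous_two (Q i) (hQ i)
  let D : (Fin m → ℂ) →ₗ[ℂ] (Fin m → ℂ) →ₗ[ℂ] (Fin c → ℂ) :=
    LinearMap.mk₂ ℂ (fun v w i => B i v w) (by intros; ext; simp) (by intros; ext; simp)
      (by intros; ext; simp) (by intros; ext; simp)
  have hD : ∀ v w i, D v w i = B i v w := fun v w i => rfl
  have hmem : ∀ x : PS m, x ∈ X ↔ D x.rep x.rep = 0 := by
    intro x
    rw [hX]
    constructor
    · intro h
      ext i
      rw [hD, ← hB]
      exact h i _ (rep_mem_submodule x)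
    · intro h i
      refine pvanish_of_forall_smul fun c => ?_
      have := congrFun h i
      rw [hD] at this
      simp only [Pi.zero_apply] at this
      rw [hB]
      simp [this]
  refine ⟨c, D, fun v w => ?_, hmem, fun x hx => le_antisymm ?_ ?_⟩
  · ext i; exact hs i v w
  · intro w hw
    rw [LinearMap.mem_ker]
    ext i
    have : polyDiff (Q i) x.rep w = 0 := by
      have h := hw
      rw [tangentSubmodule, Submodule.mem_iInf] at h
      have h' := h (Q i)
      rw [Submodule.mem_iInf] at h'
      refine h' fun y hy => ?_
      rw [hX] at hy
      exact hy i
    rw [polyDiff_apply_of_eval_eq (hs i) (hB i)] at this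
    simpa [hD] using this
  · intro w hw
    rw [tangentSubmodule]
    simp only [Submodule.mem_iInf]
    intro p hp
    refine hT x hx p hp ?_
    rw [Submodule.mem_iInf]
    intro i
    rw [LinearMap.mem_ker, polyDiff_apply_of_eval_eq (hs i) (hB i), ← hD, LinearMap.mem_ker.1 hw]
    simp

end Basics

section RankLoci

theorem exists_dual_family {F : Type*} [AddCommGroup F] [Module ℂ F] {ι : Type*} [DecidableEq ι]
    {b : ι → F} (hb : LinearIndependent ℂ b) :
    ∃ ρ : ι → F →ₗ[ℂ] ℂ, ∀ i j, ρ i (b j) = if i = j then 1 else 0 := by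
  obtain ⟨g, hg⟩ := LinearMap.exists_extend (p := Submodule.span ℂ (Set.range b))
    (hb.repr : Submodule.span ℂ (Set.range b) →ₗ[ℂ] (ι →₀ ℂ))
  refine ⟨fun i => (Finsupp.lapply i).comp g, fun i j => ?_⟩
  have h1 : g (b j) = Finsupp.single j 1 := by
    have h := LinearMap.congr_fun hg ⟨b j, Submodule.subset_span ⟨j, rfl⟩⟩
    simp only [LinearMap.comp_apply, Submodule.subtype_apply] at h
    rw [h]
    exact hb.repr_eq_single j _ rfl
  simp [h1, Finsupp.single_apply, eq_comm]

variable {E F : Type*} [AddCommGroup E] [Module ℂ E] [AddCommGroup F] [Module ℂ F] {m : ℕ}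

theorem exists_minor_polynomial (Φ₀ : E →ₗ[ℂ] F) (Φ₁ : (Fin m → ℂ) →ₗ[ℂ] E →ₗ[ℂ] F)
    {ι : Type*} [Fintype ι] [DecidableEq ι] (ρ : ι → F →ₗ[ℂ] ℂ) (ε : ι → E) :
    ∃ P : MvPolynomial (Fin m) ℂ, ∀ z, MvPolynomial.eval z P =
      (Matrix.of fun i j => ρ i ((Φ₀ + Φ₁ z) (ε j))).det := by
  let A : Matrix ι ι (MvPolynomial (Fin m) ℂ) := Matrix.of fun i j =>
    MvPolynomial.C (ρ i (Φ₀ (ε j))) + ∑ k, MvPolynomial.C (ρ i (Φ₁ (Pi.single k 1) (ε j))) *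
      MvPolynomial.X k
  refine ⟨A.det, fun z => ?_⟩
  rw [RingHom.map_det]
  congr 1
  ext i j
  have hz : z = ∑ k, z k • (Pi.single k 1 : Fin m → ℂ) := by
    ext k; simp [Finset.sum_apply, Pi.single_apply]
  conv_rhs => rw [hz]
  simp [A, mul_comm]

theorem det_eq_zero_of_finrank_range_lt [FiniteDimensional ℂ E] (Φ : E →ₗ[ℂ] F)
    {ι : Type*} [Fintype ι] [DecidableEq ι] (ρ : ι → F →ₗ[ℂ] ℂ) (ε : ι → E)
    (h : Module.finrank ℂ (LinearMap.range Φ) < Fintype.card ι) :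
    (Matrix.of fun i j => ρ i (Φ (ε j))).det = 0 := by
  by_contra hdet
  have hli : LinearIndependent ℂ (fun j => (Φ.rangeRestrict (ε j))) := by
    rw [Fintype.linearIndependent_iff]
    intro g hg
    have h0 : (Matrix.of fun i j => ρ i (Φ (ε j))).mulVec g = 0 := by
      ext i
      have := congrArg (fun y : LinearMap.range Φ => ρ i y) hg
      simpa [Matrix.mulVec, dotProduct, mul_comm] using this
    exact fun i => congrFun (Matrix.eq_zero_of_mulVec_eq_zero hdet h0) i
  exact absurd hli.fintype_card_le_finrank (not_le.2 h)

theorem exists_minor_of_le_finrank_range [FiniteDimensional ℂ E] (Φ : E →ₗ[ℂ] F) {r : ℕ}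
    (h : r ≤ Module.finrank ℂ (LinearMap.range Φ)) :
    ∃ (ρ : Fin r → F →ₗ[ℂ] ℂ) (ε : Fin r → E),
      ∀ i j, ρ i (Φ (ε j)) = if i = j then 1 else 0 := by
  let b := Module.finBasis ℂ (LinearMap.range Φ)
  have hli : LinearIndependent ℂ (fun j : Fin r => (b (Fin.castLE h j) : F)) :=
    (b.linearIndependent.map' (LinearMap.range Φ).subtype (Submodule.ker_subtype _)).comp _
      (Fin.castLE_injective h)
  obtain ⟨ρ, hρ⟩ := exists_dual_family hli
  choose ε hε using fun j : Fin r => (b (Fin.castLE h j)).2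
  exact ⟨ρ, ε, fun i j => by rw [hε, hρ]⟩

/-- The locus where an affine-linear family of maps has rank less than `r` is closed. -/
theorem zClosed_finrank_range_lt [FiniteDimensional ℂ E] (Φ₀ : E →ₗ[ℂ] F)
    (Φ₁ : (Fin m → ℂ) →ₗ[ℂ] E →ₗ[ℂ] F)
    (hsc : ∀ (c : ℂ) (v : Fin m → ℂ), c ≠ 0 →
      LinearMap.range (Φ₀ + Φ₁ (c • v)) = LinearMap.range (Φ₀ + Φ₁ v)) (r : ℕ) :
    ZClosed {x : PS m | Module.finrank ℂ (LinearMap.range (Φ₀ + Φ₁ x.rep)) < r} := by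
  choose P hP using fun (d : (Fin r → F →ₗ[ℂ] ℂ) × (Fin r → E)) =>
    exists_minor_polynomial Φ₀ Φ₁ d.1 d.2
  refine ⟨Set.range fun d : ((Fin r → F →ₗ[ℂ] ℂ) × (Fin r → E)) × Fin m =>
    MvPolynomial.X d.2 * P d.1, Set.ext fun x => ⟨?_, ?_⟩⟩
  · rintro hx _ ⟨⟨d, k⟩, rfl⟩
    refine pvanish_of_forall_smul fun c => ?_
    rcases eq_or_ne c 0 with rfl | hc
    · simp
    · simp only [map_mul]
      rw [hP, det_eq_zero_of_finrank_range_lt, mul_zero]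
      rw [hsc c _ hc, Fintype.card_fin]
      exact hx
  · intro hx
    by_contra hr
    obtain ⟨ρ, ε, h⟩ := exists_minor_of_le_finrank_range _ (not_lt.1 hr)
    obtain ⟨k, hk⟩ := Function.ne_iff.1 x.rep_nonzero
    have h0 := hx _ ⟨⟨⟨ρ, ε⟩, k⟩, rfl⟩ _ (rep_mem_submodule x)
    simp only [map_mul, MvPolynomial.eval_X, hP] at h0
    have : (Matrix.of fun i j => ρ i ((Φ₀ + Φ₁ x.rep) (ε j))) = 1 := by
      ext i j
      rw [Matrix.of_apply, h, Matrix.one_apply]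
    rw [this] at h0
    simp at h0
    exact hk h0

theorem polyDiff_eq_zero_of_mem_tangent {X : Set (PS m)} {x : PS m} {p : MvPolynomial (Fin m) ℂ}
    (hp : ∀ y ∈ X, PVanish p y) {v : Fin m → ℂ} (hv : v ∈ tangentSubmodule X x) :
    polyDiff p x.rep v = 0 := by
  simp only [tangentSubmodule, Submodule.mem_iInf] at hv
  exact hv p hp

/-- At a point of `X` of maximal rank, the derivative of a family of linear maps along a tangent
vector sends the kernel into the image. -/
theorem apply_eq_zero_of_maximal_rank [FiniteDimensional ℂ E] (Φ₀ : E →ₗ[ℂ] F)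
    (Φ₁ : (Fin m → ℂ) →ₗ[ℂ] E →ₗ[ℂ] F)
    (hsc : ∀ (c : ℂ) (v : Fin m → ℂ), c ≠ 0 →
      LinearMap.range (Φ₀ + Φ₁ (c • v)) = LinearMap.range (Φ₀ + Φ₁ v))
    {X : Set (PS m)} {x : PS m}
    (hle : ∀ y ∈ X, Module.finrank ℂ (LinearMap.range (Φ₀ + Φ₁ y.rep)) ≤
      Module.finrank ℂ (LinearMap.range (Φ₀ + Φ₁ x.rep)))
    {v : Fin m → ℂ} (hv : v ∈ tangentSubmodule X x) {μ : E} (hμ : (Φ₀ + Φ₁ x.rep) μ = 0)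
    {l : F →ₗ[ℂ] ℂ} (hl : ∀ e, l ((Φ₀ + Φ₁ x.rep) e) = 0) : l (Φ₁ v μ) = 0 := by
  obtain ⟨r, hr⟩ : ∃ r, r = Module.finrank ℂ (LinearMap.range (Φ₀ + Φ₁ x.rep)) := ⟨_, rfl⟩
  rw [← hr] at hle
  obtain ⟨ρ, ε, h⟩ := exists_minor_of_le_finrank_range (Φ₀ + Φ₁ x.rep) hr.le
  obtain ⟨P, hP⟩ := exists_minor_polynomial Φ₀ Φ₁ (Sum.elim ρ fun _ : Unit => l)
    (Sum.elim ε fun _ : Unit => μ)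
  obtain ⟨k, hk⟩ := Function.ne_iff.1 x.rep_nonzero
  have hvan : ∀ y ∈ X, PVanish (MvPolynomial.X k * P) y := by
    intro y hy
    refine pvanish_of_forall_smul fun c => ?_
    rcases eq_or_ne c 0 with rfl | hc
    · simp
    · simp only [map_mul]
      rw [hP, det_eq_zero_of_finrank_range_lt, mul_zero]
      rw [hsc c _ hc, Fintype.card_sum, Fintype.card_fin, Fintype.card_unit]
      exact Nat.lt_succ_of_le (hle y hy)
  let M : ℂ → Matrix (Fin r ⊕ Unit) (Fin r ⊕ Unit) ℂ := fun s => Matrix.fromBlocks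
    (1 + s • Matrix.of fun i j => ρ i (Φ₁ v (ε j))) (s • Matrix.of fun i _ => ρ i (Φ₁ v μ))
    (Matrix.of fun _ j => l (Φ₁ v (ε j))) (Matrix.of fun _ _ => l (Φ₁ v μ))
  have hdet : ∀ s : ℂ, MvPolynomial.eval (x.rep + s • v) P = s * (M s).det := by
    intro s
    have : (Matrix.of fun i j => (Sum.elim ρ (fun _ : Unit => l) i)
        ((Φ₀ + Φ₁ (x.rep + s • v)) (Sum.elim ε (fun _ : Unit => μ) j)))
        = Matrix.fromBlocks 1 0 0 (s • 1) * M s := by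
      have hadd : ∀ e, (Φ₀ + Φ₁ (x.rep + s • v)) e = (Φ₀ + Φ₁ x.rep) e + s • Φ₁ v e := by
        intro e; simp [add_assoc]
      rw [Matrix.fromBlocks_multiply]
      ext i j
      rw [Matrix.of_apply, hadd]
      rcases i with i | i <;> rcases j with j | j <;>
        simp only [Sum.elim_inl, Sum.elim_inr, map_add, map_smul, hμ, hl, h]
      · simp [Matrix.one_apply]
      · simp
      · simp
      · simp
    rw [hP, this, Matrix.det_mul, Matrix.det_fromBlocks_zero₂₁]
    simp
  have hM0 : (M 0).det = l (Φ₁ v μ) := by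
    have : M 0 = Matrix.fromBlocks 1 0 (Matrix.of fun _ j => l (Φ₁ v (ε j)))
        (Matrix.of fun _ _ => l (Φ₁ v μ)) := by
      simp [M]
    rw [this, Matrix.det_fromBlocks_zero₁₂]
    simp
  have hcont : Continuous fun s => (M s).det := by
    refine Continuous.matrix_det ?_
    refine Continuous.matrix_fromBlocks ?_ ?_ ?_ ?_ <;> fun_prop
  have hd1 : HasDerivAt (fun s : ℂ => MvPolynomial.eval (x.rep + s • v) P) (l (Φ₁ v μ)) 0 := by
    rw [hasDerivAt_iff_tendsto_slope_zero]
    simp only [hdet, zero_mul, sub_zero, zero_add, smul_eq_mul]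
    rw [← hM0]
    refine (hcont.continuousAt.tendsto.mono_left nhdsWithin_le_nhds).congr' ?_
    filter_upwards [self_mem_nhdsWithin] with s hs
    rw [inv_mul_cancel_left₀ hs]
  have hline : ∀ i, HasDerivAt (fun s : ℂ => (x.rep + s • v) i) (v i) 0 := fun i => by
    simpa using ((hasDerivAt_id (0 : ℂ)).mul_const (v i)).const_add (x.rep i)
  have hd2 := hasDerivAt_eval_comp (MvPolynomial.X k * P) hline
  have hd3 := (hline k).fun_mul hd1
  simp only [map_mul, MvPolynomial.eval_X] at hd2
  have h4 := hd2.unique hd3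
  simp only [zero_smul, add_zero] at h4
  rw [polyDiff_eq_zero_of_mem_tangent hvan hv] at h4
  have h5 := hdet 0
  simp only [zero_smul, add_zero, zero_mul] at h5
  rw [h5] at h4
  simp only [mul_zero, zero_add] at h4
  exact (mul_eq_zero.1 h4.symm).resolve_left hk

end RankLoci

section QuadraticSystems

variable {m c : ℕ} {X : Set (PS m)} {D : (Fin m → ℂ) →ₗ[ℂ] (Fin m → ℂ) →ₗ[ℂ] (Fin c → ℂ)}

/-- The second fundamental form at `x` takes values in the conormal image of `D x`. -/
theorem mem_range_of_mem_tangent (htan : ∀ x ∈ X, tangentSubmodule X x = LinearMap.ker (D x.rep))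
    {n : ℕ} (hdim : ∀ x ∈ X, Module.finrank ℂ (tangentSubmodule X x) = n) {x : PS m} (hx : x ∈ X)
    {v w : Fin m → ℂ} (hv : D x.rep v = 0) (hw : D x.rep w = 0) :
    D v w ∈ LinearMap.range (D x.rep) := by
  have hrk : ∀ y ∈ X, Module.finrank ℂ (LinearMap.range (D y.rep)) + n = m := by
    intro y hy
    rw [← hdim y hy, htan y hy, LinearMap.finrank_range_add_finrank_ker]
    simp
  by_contra hnot
  obtain ⟨l, hl, hl'⟩ := Submodule.exists_le_ker_of_notMem hnot
  refine hl ?_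
  refine apply_eq_zero_of_maximal_rank (0 : (Fin m → ℂ) →ₗ[ℂ] (Fin c → ℂ)) D ?_ (X := X) (x := x)
    ?_ (v := v) ?_ ?_ ?_
  · intro a u ha
    simp only [zero_add, map_smul]
    exact LinearMap.range_smul _ _ ha
  · intro y hy
    have h0 : ∀ z, (0 : (Fin m → ℂ) →ₗ[ℂ] (Fin c → ℂ)) + D z = D z := fun z => zero_add _
    rw [h0, h0]
    have h1 := hrk y hy
    have h2 := hrk x hx
    omega
  · rw [htan x hx]; exact hv
  · simpa using hw
  · intro e
    simpa using hl' ⟨e, rfl⟩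

/-- The correction term lifting a syzygy `L` on the tangent space, for a projection `π`. -/
def syzygyCorrection (D : (Fin m → ℂ) →ₗ[ℂ] (Fin m → ℂ) →ₗ[ℂ] (Fin c → ℂ))
    (S : (Fin c → ℂ) →ₗ[ℂ] (Fin m → ℂ)) (L : (Fin m → ℂ) →ₗ[ℂ] Module.Dual ℂ (Fin c → ℂ))
    (π : (Fin m → ℂ) →ₗ[ℂ] (Fin m → ℂ)) :
    (Fin m → ℂ) →ₗ[ℂ] (Fin m → ℂ) →ₗ[ℂ] Module.Dual ℂ (Fin c → ℂ) :=
  LinearMap.mk₂ ℂ (fun w w' => (L (π w)).comp ((D (π w' + w')).comp S))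
    (by intros; ext; simp) (by intros; ext; simp)
    (by intros; ext; simp; ring) (by intros; ext; simp; ring)

theorem syzygyCorrection_apply (S : (Fin c → ℂ) →ₗ[ℂ] (Fin m → ℂ))
    (L : (Fin m → ℂ) →ₗ[ℂ] Module.Dual ℂ (Fin c → ℂ)) (π : (Fin m → ℂ) →ₗ[ℂ] (Fin m → ℂ))
    (w w' : Fin m → ℂ) (k : Fin c → ℂ) :
    syzygyCorrection D S L π w w' k = L (π w) (D (π w' + w') (S k)) := rfl

/-- The domain of the family whose ranks detect lifts of syzygies. -/
def SyzygyData (m c : ℕ) : Type :=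
  ((Fin m → ℂ) →ₗ[ℂ] Module.Dual ℂ (Fin c → ℂ)) ×
    ((Fin m → ℂ) →ₗ[ℂ] (Fin m → ℂ) →ₗ[ℂ] Module.Dual ℂ (Fin c → ℂ))

instance (m c : ℕ) : AddCommGroup (SyzygyData m c) :=
  inferInstanceAs (AddCommGroup (((Fin m → ℂ) →ₗ[ℂ] Module.Dual ℂ (Fin c → ℂ)) ×
    ((Fin m → ℂ) →ₗ[ℂ] (Fin m → ℂ) →ₗ[ℂ] Module.Dual ℂ (Fin c → ℂ))))

instance (m c : ℕ) : Module ℂ (SyzygyData m c) :=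
  inferInstanceAs (Module ℂ (((Fin m → ℂ) →ₗ[ℂ] Module.Dual ℂ (Fin c → ℂ)) ×
    ((Fin m → ℂ) →ₗ[ℂ] (Fin m → ℂ) →ₗ[ℂ] Module.Dual ℂ (Fin c → ℂ))))

instance (m c : ℕ) : FiniteDimensional ℂ (SyzygyData m c) :=
  inferInstanceAs (Module.Finite ℂ (((Fin m → ℂ) →ₗ[ℂ] Module.Dual ℂ (Fin c → ℂ)) ×
    ((Fin m → ℂ) →ₗ[ℂ] (Fin m → ℂ) →ₗ[ℂ] Module.Dual ℂ (Fin c → ℂ))))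

namespace SyzygyData

theorem fst_add (e e' : SyzygyData m c) : (e + e').1 = e.1 + e'.1 := rfl
theorem snd_add (e e' : SyzygyData m c) : (e + e').2 = e.2 + e'.2 := rfl
theorem fst_smul (a : ℂ) (e : SyzygyData m c) : (a • e).1 = a • e.1 := rfl
theorem snd_smul (a : ℂ) (e : SyzygyData m c) : (a • e).2 = a • e.2 := rfl

end SyzygyData

/-- The evaluation data `(l, h) ↦ (w ↦ l w (D w w))`. -/
def syzygyConst (D : (Fin m → ℂ) →ₗ[ℂ] (Fin m → ℂ) →ₗ[ℂ] (Fin c → ℂ)) :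
    SyzygyData m c →ₗ[ℂ] ((Fin m → ℂ) → ℂ) where
  toFun e w := e.1 w (D w w)
  map_add' _ _ := by ext; simp [SyzygyData.fst_add]
  map_smul' _ _ := by ext; simp [SyzygyData.fst_smul]

/-- The evaluation data `(l, h) ↦ (w ↦ - h w w (D z w))`, linear in the point `z`. -/
def syzygyLin (D : (Fin m → ℂ) →ₗ[ℂ] (Fin m → ℂ) →ₗ[ℂ] (Fin c → ℂ)) :
    (Fin m → ℂ) →ₗ[ℂ] SyzygyData m c →ₗ[ℂ] ((Fin m → ℂ) → ℂ) :=
  LinearMap.mk₂ ℂ (fun z e w => - e.2 w w (D z w))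
    (by intros; ext; simp; ring) (by intros; ext; simp)
    (by intros; ext; simp [SyzygyData.snd_add]; ring)
    (by intros; ext; simp [SyzygyData.snd_smul])

theorem syzygyConst_apply (e : SyzygyData m c) (w : Fin m → ℂ) :
    syzygyConst D e w = e.1 w (D w w) := rfl

theorem syzygyLin_apply (z : Fin m → ℂ) (e : SyzygyData m c) (w : Fin m → ℂ) :
    syzygyLin D z e w = - e.2 w w (D z w) := rfl

theorem range_syzygy_smul (a : ℂ) (v : Fin m → ℂ) (ha : a ≠ 0) :
    LinearMap.range (syzygyConst D + syzygyLin D (a • v))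
      = LinearMap.range (syzygyConst D + syzygyLin D v) := by
  have hsub : ∀ (a : ℂ) (v : Fin m → ℂ), LinearMap.range (syzygyConst D + syzygyLin D (a • v))
      ≤ LinearMap.range (syzygyConst D + syzygyLin D v) := by
    rintro a v _ ⟨e, rfl⟩
    obtain ⟨e', h₁, h₂⟩ : ∃ e' : SyzygyData m c, e'.1 = e.1 ∧ e'.2 = a • e.2 :=
      ⟨(e.1, a • e.2), rfl, rfl⟩
    refine ⟨e', ?_⟩
    ext w
    simp [syzygyConst_apply, syzygyLin_apply, h₁, h₂]
  refine le_antisymm (hsub a v) ?_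
  have := hsub a⁻¹ (a • v)
  rwa [inv_smul_smul₀ ha] at this

theorem syzygy_lift_of_maximal_rank (hs : ∀ v w, D v w = D w v)
    (htan : ∀ x ∈ X, tangentSubmodule X x = LinearMap.ker (D x.rep)) {x : PS m} (hx : x ∈ X)
    (hmax : ∀ y ∈ X, Module.finrank ℂ (LinearMap.range (syzygyConst D + syzygyLin D y.rep)) ≤
      Module.finrank ℂ (LinearMap.range (syzygyConst D + syzygyLin D x.rep)))
    {S : (Fin c → ℂ) →ₗ[ℂ] (Fin m → ℂ)} (hS : ∀ w, D x.rep (S (D x.rep w)) = D x.rep w)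
    {L : (Fin m → ℂ) →ₗ[ℂ] Module.Dual ℂ (Fin c → ℂ)}
    (hL : ∀ w, D x.rep w = 0 → L w (D w w) = 0)
    {t : Fin m → ℂ} (ht : D x.rep t = 0) (htt : D t t = 0) {v : Fin m → ℂ} (hv : D x.rep v = 0) :
    L t (D t (S (D v t))) = 0 := by
  obtain ⟨π, hπ⟩ : ∃ π : (Fin m → ℂ) →ₗ[ℂ] (Fin m → ℂ), ∀ w, π w = w - S (D x.rep w) :=
    ⟨LinearMap.id - S.comp (D x.rep), fun w => rfl⟩
  have hπt : π t = t := by rw [hπ, ht]; simp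
  obtain ⟨e, he₁, he₂⟩ : ∃ e : SyzygyData m c, e.1 = L.comp π ∧
      e.2 = syzygyCorrection D S L π := ⟨(_, _), rfl, rfl⟩
  have hker : (syzygyConst D + syzygyLin D x.rep) e = 0 := by
    ext w
    have h1 : D x.rep (π w) = 0 := by rw [hπ, map_sub, hS, sub_self]
    have h2 := hL _ h1
    have h3 : S (D x.rep w) = w - π w := by rw [hπ]; abel
    rw [LinearMap.add_apply, Pi.add_apply, syzygyConst_apply, syzygyLin_apply, he₁, he₂,
      syzygyCorrection_apply, h3, LinearMap.comp_apply, Pi.zero_apply]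
    simp only [map_add, map_sub, LinearMap.add_apply, hs w (π w)]
    linear_combination h2
  have key := apply_eq_zero_of_maximal_rank (syzygyConst D) (syzygyLin D) range_syzygy_smul hmax
    (v := v) (by rw [htan x hx]; exact hv) hker (l := LinearMap.proj t) fun e => by
      rw [LinearMap.proj_apply, LinearMap.add_apply, Pi.add_apply, syzygyConst_apply,
        syzygyLin_apply, ht, htt]
      simp
  rw [LinearMap.proj_apply, syzygyLin_apply, he₂, syzygyCorrection_apply, hπt] at key
  simp only [map_add, LinearMap.add_apply] at key
  have h2 : (2 : ℂ) * L t (D t (S (D v t))) = 0 := by linear_combination -key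
  simpa using h2

/-- Every linear syzygy among the quadrics `t ↦ D t t` on the tangent space at a general point
satisfies a first order lifting condition. -/
theorem genericallyOn_syzygy_lift (hirr : ZIrreducible X) (hs : ∀ v w, D v w = D w v)
    (htan : ∀ x ∈ X, tangentSubmodule X x = LinearMap.ker (D x.rep)) :
    GenericallyOn X fun x => ∀ S : (Fin c → ℂ) →ₗ[ℂ] (Fin m → ℂ),
      (∀ w, D x.rep (S (D x.rep w)) = D x.rep w) →
      ∀ L : (Fin m → ℂ) →ₗ[ℂ] Module.Dual ℂ (Fin c → ℂ),
      (∀ w, D x.rep w = 0 → L w (D w w) = 0) →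
      ∀ t, D x.rep t = 0 → D t t = 0 → ∀ v, D x.rep v = 0 → L t (D t (S (D v t))) = 0 := by
  obtain ⟨rk, hrk⟩ : ∃ rk : PS m → ℕ, ∀ x, rk x =
      Module.finrank ℂ (LinearMap.range (syzygyConst D + syzygyLin D x.rep)) := ⟨_, fun _ => rfl⟩
  obtain ⟨x₀, hx₀, hmax⟩ : ∃ x₀ ∈ X, ∀ y ∈ X, rk y ≤ rk x₀ := by
    have hbdd : BddAbove (rk '' X) :=
      ⟨_, by rintro _ ⟨y, -, rfl⟩; rw [hrk]; exact LinearMap.finrank_range_le _⟩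
    obtain ⟨x₀, hx₀, h⟩ := Nat.sSup_mem (hirr.1.image rk) hbdd
    exact ⟨x₀, hx₀, fun y hy => h ▸ le_csSup hbdd ⟨y, hy, rfl⟩⟩
  refine ⟨{x | rk x < rk x₀}, ?_, fun h => lt_irrefl (rk x₀) (h hx₀), ?_⟩
  · simp only [hrk]
    exact zClosed_finrank_range_lt _ _ range_syzygy_smul _
  · intro x hx S hS L hL t ht htt v hv
    refine syzygy_lift_of_maximal_rank hs htan hx.1 (fun y hy => ?_) hS hL ht htt hv
    rw [← hrk, ← hrk]
    exact (hmax y hy).trans (not_lt.1 hx.2)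

end QuadraticSystems

section Plucker

theorem pluckerVec_add_left (a a' b : Fin 5 → ℂ) :
    pluckerVec (a + a') b = pluckerVec a b + pluckerVec a' b := by
  ext k; simp [pluckerVec]; ring

theorem pluckerVec_add_right (a b b' : Fin 5 → ℂ) :
    pluckerVec a (b + b') = pluckerVec a b + pluckerVec a b' := by
  ext k; simp [pluckerVec]; ring

theorem pluckerVec_smul_left (c : ℂ) (a b : Fin 5 → ℂ) :
    pluckerVec (c • a) b = c • pluckerVec a b := by
  ext k; simp [pluckerVec]; ring

theorem pluckerVec_smul_right (c : ℂ) (a b : Fin 5 → ℂ) :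
    pluckerVec a (c • b) = c • pluckerVec a b := by
  ext k; simp [pluckerVec]; ring

theorem pluckerVec_swap (a b : Fin 5 → ℂ) : pluckerVec b a = - pluckerVec a b := by
  ext k; simp [pluckerVec]; ring

theorem pluckerVec_self (a : Fin 5 → ℂ) : pluckerVec a a = 0 := by
  ext k; simp [pluckerVec]; ring

theorem single_eq_pluckerVec (k : Fin 10) :
    (Pi.single k 1 : Fin 10 → ℂ) =
      pluckerVec (Pi.single (pluckerPair k).1 1) (Pi.single (pluckerPair k).2 1) := by
  ext j
  fin_cases k <;> fin_cases j <;> simp [pluckerVec, pluckerPair]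

theorem linearMap_eq_zero_of_pluckerVec {F : Type*} [AddCommGroup F] [Module ℂ F]
    {f : (Fin 10 → ℂ) →ₗ[ℂ] F} (h : ∀ a b, f (pluckerVec a b) = 0) : f = 0 := by
  refine LinearMap.pi_ext' fun k => LinearMap.ext_ring ?_
  simp [single_eq_pluckerVec, h]

/-- The polarized sub-Pfaffians, with alternating signs. -/
def pfaffPolar : (Fin 10 → ℂ) →ₗ[ℂ] (Fin 10 → ℂ) →ₗ[ℂ] (Fin 5 → ℂ) :=
  LinearMap.mk₂ ℂ (fun A C =>
    ![A 4 * C 9 + A 9 * C 4 - A 5 * C 8 - A 8 * C 5 + A 6 * C 7 + A 7 * C 6,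
      -(A 1 * C 9 + A 9 * C 1 - A 2 * C 8 - A 8 * C 2 + A 3 * C 7 + A 7 * C 3),
      A 0 * C 9 + A 9 * C 0 - A 2 * C 6 - A 6 * C 2 + A 3 * C 5 + A 5 * C 3,
      -(A 0 * C 8 + A 8 * C 0 - A 1 * C 6 - A 6 * C 1 + A 3 * C 4 + A 4 * C 3),
      A 0 * C 7 + A 7 * C 0 - A 1 * C 5 - A 5 * C 1 + A 2 * C 4 + A 4 * C 2])
    (by intro A A' C; ext i; fin_cases i <;> simp <;> ring)
    (by intro r A C; ext i; fin_cases i <;> simp <;> ring)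
    (by intro A C C'; ext i; fin_cases i <;> simp <;> ring)
    (by intro r A C; ext i; fin_cases i <;> simp <;> ring)

theorem pfaffPolar_apply (A C : Fin 10 → ℂ) : pfaffPolar A C =
    ![A 4 * C 9 + A 9 * C 4 - A 5 * C 8 - A 8 * C 5 + A 6 * C 7 + A 7 * C 6,
      -(A 1 * C 9 + A 9 * C 1 - A 2 * C 8 - A 8 * C 2 + A 3 * C 7 + A 7 * C 3),
      A 0 * C 9 + A 9 * C 0 - A 2 * C 6 - A 6 * C 2 + A 3 * C 5 + A 5 * C 3,
      -(A 0 * C 8 + A 8 * C 0 - A 1 * C 6 - A 6 * C 1 + A 3 * C 4 + A 4 * C 3),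
      A 0 * C 7 + A 7 * C 0 - A 1 * C 5 - A 5 * C 1 + A 2 * C 4 + A 4 * C 2] := rfl

theorem pfaffPolar_pluckerVec (a b : Fin 5 → ℂ) :
    pfaffPolar (pluckerVec a b) (pluckerVec a b) = 0 := by
  rw [pfaffPolar_apply]
  ext i; fin_cases i <;> simp [pluckerVec, pluckerPair] <;> ring

/-- The skew-symmetric matrix with the given entries above the diagonal. -/
def skewMat : (Fin 10 → ℂ) →ₗ[ℂ] Matrix (Fin 5) (Fin 5) ℂ where
  toFun A := !![0, A 0, A 1, A 2, A 3; -A 0, 0, A 4, A 5, A 6; -A 1, -A 4, 0, A 7, A 8;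
    -A 2, -A 5, -A 7, 0, A 9; -A 3, -A 6, -A 8, -A 9, 0]
  map_add' A C := by ext i j; fin_cases i <;> fin_cases j <;> simp <;> ring
  map_smul' r A := by ext i j; fin_cases i <;> fin_cases j <;> simp

theorem skewMat_apply (A : Fin 10 → ℂ) : skewMat A =
    !![0, A 0, A 1, A 2, A 3; -A 0, 0, A 4, A 5, A 6; -A 1, -A 4, 0, A 7, A 8;
    -A 2, -A 5, -A 7, 0, A 9; -A 3, -A 6, -A 8, -A 9, 0] := rfl

theorem skewMat_pluckerVec (a b : Fin 5 → ℂ) (i j : Fin 5) :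
    skewMat (pluckerVec a b) i j = a i * b j - a j * b i := by
  rw [skewMat_apply]
  fin_cases i <;> fin_cases j <;> simp [pluckerVec, pluckerPair, mul_comm] <;> ring

/-- The linear syzygies among the sub-Pfaffians. -/
theorem sum_skewMat_mul_pfaffPolar (A : Fin 10 → ℂ) (a : Fin 5) :
    ∑ i, skewMat A a i * pfaffPolar A A i = 0 := by
  rw [skewMat_apply, pfaffPolar_apply]
  fin_cases a <;> simp [Fin.sum_univ_five] <;> ring

set_option maxHeartbeats 1000000 in
/-- The ideal of the Grassmannian in degree two is spanned by the sub-Pfaffians. -/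
theorem exists_eq_sum_pfaffPolar {F : Type*} [AddCommGroup F] [Module ℂ F]
    {β : (Fin 10 → ℂ) →ₗ[ℂ] (Fin 10 → ℂ) →ₗ[ℂ] F} (hs : ∀ A C, β A C = β C A)
    (h : ∀ a b, β (pluckerVec a b) (pluckerVec a b) = 0) :
    ∃ n : Fin 5 → F, ∀ A C, β A C = ∑ i, pfaffPolar A C i • n i := by
  have two : ∀ y : F, y + y = 0 → y = 0 := fun y hy => by
    rw [← two_smul ℂ] at hy
    exact (smul_eq_zero.1 hy).resolve_left two_ne_zero
  have h1 : ∀ a b b', β (pluckerVec a b) (pluckerVec a b') = 0 := by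
    intro a b b'
    have := h a (b + b')
    simp only [pluckerVec_add_right, map_add, LinearMap.add_apply, h, zero_add, add_zero] at this
    rw [hs (pluckerVec a b') (pluckerVec a b)] at this
    exact two _ this
  have h1' : ∀ a a' b, β (pluckerVec a b) (pluckerVec a' b) = 0 := by
    intro a a' b
    rw [pluckerVec_swap b a, pluckerVec_swap b a']
    simp [h1]
  have h2 : ∀ a b a' b', β (pluckerVec a b) (pluckerVec a' b')
      = - β (pluckerVec a b') (pluckerVec a' b) := by
    intro a b a' b'
    have := h1 (a + a') b b'
    simp only [pluckerVec_add_left, map_add, LinearMap.add_apply, h1, zero_add, add_zero] at this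
    rw [eq_neg_iff_add_eq_zero, hs (pluckerVec a b') (pluckerVec a' b), add_comm, ← this]
  have h3 : ∀ a b a' b', β (pluckerVec a b) (pluckerVec a' b')
      = - β (pluckerVec a a') (pluckerVec b b') := by
    intro a b a' b'
    rw [pluckerVec_swap b' a', map_neg, h2 a b b' a', neg_neg, pluckerVec_swap b b', map_neg]
  have h4 : ∀ a b a' b', β (pluckerVec a b) (pluckerVec a' b')
      = β (pluckerVec a a') (pluckerVec b' b) := by
    intro a b a' b'
    rw [h3, pluckerVec_swap b' b, map_neg, neg_neg]
  have h5 : ∀ a b b', β (pluckerVec a b) (pluckerVec b b') = 0 := by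
    intro a b b'
    rw [pluckerVec_swap b a]
    simp [h1]
  have h6 : ∀ a b a', β (pluckerVec a b) (pluckerVec a' a) = 0 := by
    intro a b a'
    rw [pluckerVec_swap b a]
    simp [h1']
  obtain ⟨g, hg⟩ : ∃ g : Fin 5 → Fin 5 → Fin 5 → Fin 5 → F, ∀ i j k l, g i j k l =
      β (pluckerVec (Pi.single i 1) (Pi.single j 1))
        (pluckerVec (Pi.single k 1) (Pi.single l 1)) := ⟨_, fun _ _ _ _ => rfl⟩
  have g0 : ∀ i j, g i j i j = 0 := fun i j => by rw [hg, h]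
  have g1 : ∀ i j k, g i j i k = 0 := fun i j k => by rw [hg, h1]
  have g1' : ∀ i j k, g i j k j = 0 := fun i j k => by rw [hg, h1']
  have g3 : ∀ i j k l, g i j k l = - g i k j l := fun i j k l => by rw [hg, hg, h3]
  have g4 : ∀ i j k l, g i j k l = g i k l j := fun i j k l => by rw [hg, hg, h4]
  have g5 : ∀ i j k, g i j j k = 0 := fun i j k => by rw [hg, h5]
  have g6 : ∀ i j k, g i j k i = 0 := fun i j k => by rw [hg, h6]
  have gs : ∀ i j k l, g i j k l = g k l i j := fun i j k l => by rw [hg, hg, hs]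
  have gs3 : ∀ i j k l, g i j k l = - g k i l j := fun i j k l => by rw [gs, g3]
  have gs4 : ∀ i j k l, g i j k l = g k i j l := fun i j k l => by rw [gs, g4]
  obtain ⟨n, hn⟩ : ∃ n : Fin 5 → F,
      n = ![g 1 2 3 4, -g 0 2 3 4, g 0 1 3 4, -g 0 1 2 4, g 0 1 2 3] := ⟨_, rfl⟩
  have key : β = pfaffPolar.compr₂ (Fintype.linearCombination ℂ n) := by
    refine LinearMap.pi_ext' fun i => LinearMap.ext_ring (LinearMap.pi_ext' fun j =>
      LinearMap.ext_ring ?_)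
    simp only [LinearMap.comp_apply, LinearMap.single_apply, LinearMap.compr₂_apply,
      Fintype.linearCombination_apply, pfaffPolar_apply, Fin.sum_univ_five]
    conv_lhs => rw [single_eq_pluckerVec, single_eq_pluckerVec, ← hg]
    clear hg h h1 h1' h2 h3 h4 h5 h6 hs
    subst hn
    fin_cases i <;> fin_cases j <;>
      simp [pluckerPair, g0, g1, g1', g5, g6]
    all_goals first
      | exact g3 _ _ _ _
      | exact g4 _ _ _ _
      | exact gs _ _ _ _
      | exact gs3 _ _ _ _
      | exact gs4 _ _ _ _
  refine ⟨n, fun A C => ?_⟩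
  rw [key]
  simp [Fintype.linearCombination_apply]

end Plucker

section Plucker

theorem exists_pfaffPolar_self_eq (c : Fin 5 → ℂ) : ∃ A, pfaffPolar A A = c := by
  by_cases h0 : c 0 = 0
  · by_cases h1 : c 1 = 0
    · refine ⟨![1, 0, 0, 0, 0, 0, 0, c 4 / 2, -c 3 / 2, c 2 / 2], ?_⟩
      rw [pfaffPolar_apply]
      ext i; fin_cases i <;> simp [h0, h1]
    · refine ⟨![c 2 / (-c 1), 1, 0, 0, 0, -c 4 / 2, c 3 / 2, 0, 0, -c 1 / 2], ?_⟩
      rw [pfaffPolar_apply]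
      ext i; fin_cases i <;> simp [h0] <;> field_simp <;> ring
  · refine ⟨![c 2 / c 0, -c 1 / c 0, c 4 / 2, -c 3 / 2, 1, 0, 0, 0, 0, c 0 / 2], ?_⟩
    rw [pfaffPolar_apply]
    ext i; fin_cases i <;> simp <;> field_simp <;> ring

theorem exists_pluckerVec_ne_zero {s : Fin 5 → ℂ} (hs : s ≠ 0) : ∃ w, pluckerVec s w ≠ 0 := by
  by_contra! h
  refine hs (funext fun i => ?_)
  have h1 : ∀ (w : Fin 5 → ℂ) a b, s a * w b - s b * w a = 0 := fun w a b => by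
    rw [← skewMat_pluckerVec, h w]; simp
  obtain ⟨j, hj⟩ := exists_ne i
  simpa [hj.symm] using h1 (Pi.single j 1) i j

/-- A quadric containing the Grassmannian is singular. -/
theorem exists_sum_mul_pfaffPolar_eq_zero (s : Fin 5 → ℂ) :
    ∃ A, A ≠ 0 ∧ ∀ C, ∑ i, s i * pfaffPolar A C i = 0 := by
  by_cases hs : s = 0
  · exact ⟨Pi.single 0 1, by simp, fun C => by simp [hs]⟩
  · obtain ⟨w, hw⟩ := exists_pluckerVec_ne_zero hs
    refine ⟨_, hw, fun C => ?_⟩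
    rw [pfaffPolar_apply, Fin.sum_univ_five]
    simp [pluckerVec, pluckerPair]
    ring

theorem bilin_eq_zero_of_generic_pluckerVec
    {β q : (Fin 10 → ℂ) →ₗ[ℂ] (Fin 10 → ℂ) →ₗ[ℂ] ℂ}
    (hq : ∃ a b, q (pluckerVec a b) (pluckerVec a b) ≠ 0)
    (h : ∀ a b, q (pluckerVec a b) (pluckerVec a b) ≠ 0 →
      β (pluckerVec a b) (pluckerVec a b) = 0) (a b : Fin 5 → ℂ) :
    β (pluckerVec a b) (pluckerVec a b) = 0 := by
  obtain ⟨a₀, b₀, h₀⟩ := hq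
  obtain ⟨A₁, hA₁⟩ : ∃ A₁, A₁ = pluckerVec a₀ (b - b₀) + pluckerVec (a - a₀) b₀ := ⟨_, rfl⟩
  obtain ⟨A₂, hA₂⟩ : ∃ A₂, A₂ = pluckerVec (a - a₀) (b - b₀) := ⟨_, rfl⟩
  obtain ⟨A₀, hA₀⟩ : ∃ A₀, A₀ = pluckerVec a₀ b₀ := ⟨_, rfl⟩
  let A : ℂ → Fin 10 → ℂ := fun s => pluckerVec (a₀ + s • (a - a₀)) (b₀ + s • (b - b₀))
  have hA : ∀ s, A s = A₀ + s • A₁ + s ^ 2 • A₂ := fun s => by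
    simp only [A, hA₀, hA₁, hA₂, pluckerVec_add_left, pluckerVec_add_right, pluckerVec_smul_left,
      pluckerVec_smul_right]
    module
  let P : ((Fin 10 → ℂ) →ₗ[ℂ] (Fin 10 → ℂ) →ₗ[ℂ] ℂ) → Polynomial ℂ := fun q =>
    .C (q A₀ A₀) + .C (q A₀ A₁ + q A₁ A₀) * .X + .C (q A₀ A₂ + q A₁ A₁ + q A₂ A₀) * .X ^ 2
      + .C (q A₁ A₂ + q A₂ A₁) * .X ^ 3 + .C (q A₂ A₂) * .X ^ 4
  have hP : ∀ q s, (P q).eval s = q (A s) (A s) := by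
    intro q s
    rw [hA]
    simp [P]
    ring
  have hPQ : P β * P q = 0 := by
    refine Polynomial.funext fun s => ?_
    rw [Polynomial.eval_mul, hP, hP, Polynomial.eval_zero, mul_eq_zero, or_iff_not_imp_right]
    exact h _ _
  have hQ0 : P q ≠ 0 := fun h0 => h₀ (by simpa [h0, A] using (hP q 0).symm)
  simpa [(mul_eq_zero.1 hPQ).resolve_right hQ0, A] using (hP β 1).symm

theorem linearMap_eq_zero_of_generic_pluckerVec {F : Type*} [AddCommGroup F] [Module ℂ F]
    {m : (Fin 10 → ℂ) →ₗ[ℂ] F} {q : (Fin 10 → ℂ) →ₗ[ℂ] (Fin 10 → ℂ) →ₗ[ℂ] ℂ}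
    (hq : ∃ a b, q (pluckerVec a b) (pluckerVec a b) ≠ 0)
    (h : ∀ a b, q (pluckerVec a b) (pluckerVec a b) ≠ 0 → m (pluckerVec a b) = 0) : m = 0 := by
  refine linearMap_eq_zero_of_pluckerVec fun a b => ?_
  refine (Module.forall_dual_apply_eq_zero_iff ℂ _).1 fun φ => ?_
  have := bilin_eq_zero_of_generic_pluckerVec
    (β := (LinearMap.mul ℂ ℂ).compl₁₂ (φ.comp m) (φ.comp m)) hq
    (fun a b hab => by simp [h a b hab]) a b
  simpa using this

/-- A hyperplane section of the Grassmannian spans the hyperplane, even after discarding the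
locus where the hyperplane is tangent. -/
theorem exists_eq_smul_of_pluckerVec {m l : (Fin 10 → ℂ) →ₗ[ℂ] ℂ} (hm : m ≠ 0)
    (h : ∀ a b, m (pluckerVec a b) = 0 → (∃ a', m (pluckerVec a' b) ≠ 0) →
      l (pluckerVec a b) = 0) : ∃ c : ℂ, l = c • m := by
  obtain ⟨b₁, b₂, hb⟩ : ∃ b₁ b₂, m (pluckerVec b₁ b₂) = 1 := by
    by_contra! hne
    refine hm (linearMap_eq_zero_of_pluckerVec fun a b => ?_)
    by_contra h0
    refine hne ((m (pluckerVec a b))⁻¹ • a) b ?_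
    rw [pluckerVec_smul_left, map_smul, smul_eq_mul, inv_mul_cancel₀ h0]
  refine ⟨l (pluckerVec b₁ b₂), sub_eq_zero.1 ?_⟩
  obtain ⟨k, hk⟩ : ∃ k, k = l - l (pluckerVec b₁ b₂) • m := ⟨_, rfl⟩
  rw [← hk]
  have h' : ∀ a b, m (pluckerVec a b) = 0 → (∃ a', m (pluckerVec a' b) ≠ 0) →
      k (pluckerVec a b) = 0 := fun a b h1 h2 => by simp [hk, h a b h1 h2, h1]
  have k12 : k (pluckerVec b₁ b₂) = 0 := by simp [hk, hb]
  have swap : ∀ (f : (Fin 10 → ℂ) →ₗ[ℂ] ℂ) a b, f (pluckerVec b a) = - f (pluckerVec a b) :=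
    fun f a b => by rw [pluckerVec_swap, map_neg]
  have hk1 : ∀ w, m (pluckerVec b₁ w) = 0 → k (pluckerVec w b₁) = 0 := fun w hw =>
    h' _ _ (by rw [swap, hw, neg_zero]) ⟨b₂, by rw [swap, hb]; simp⟩
  have hk2 : ∀ w, m (pluckerVec w b₂) = 0 → k (pluckerVec w b₂) = 0 := fun w hw =>
    h' _ _ hw ⟨b₁, by rw [hb]; simp⟩
  have hkw : ∀ w w', m (pluckerVec b₁ w) = 0 → m (pluckerVec w b₂) = 0 →
      m (pluckerVec b₁ w') = 0 → m (pluckerVec w' b₂) = 0 → k (pluckerVec w w') = 0 := by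
    intro w w' h1 h2 h1' h2'
    by_cases hμ : m (pluckerVec w w') = 0
    · have := h' w (w' + b₂) (by simp [-neg_smul, pluckerVec_add_right, hμ, h2])
        ⟨b₁, by simp [-neg_smul, pluckerVec_add_right, h1', hb]⟩
      simpa [-neg_smul, pluckerVec_add_right, hk2 w h2] using this
    · obtain ⟨μ, hμ'⟩ : ∃ μ, μ = m (pluckerVec w w') := ⟨_, rfl⟩
      have := h' (b₁ + w) (w' + (-μ) • b₂)
        (by simp [-neg_smul, pluckerVec_add_left, pluckerVec_add_right, pluckerVec_smul_right, h1', h2, hb,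
          hμ'])
        ⟨b₁, by simp [-neg_smul, pluckerVec_add_right, pluckerVec_smul_right, h1', hb, hμ', hμ]⟩
      simpa [-neg_smul, pluckerVec_add_left, pluckerVec_add_right, pluckerVec_smul_right, k12, hk2 w h2,
        swap k w' b₁, hk1 w' h1'] using this
  have dec : ∀ a, ∃ x y w, a = x • b₁ + y • b₂ + w ∧ m (pluckerVec b₁ w) = 0 ∧
      m (pluckerVec w b₂) = 0 := fun a =>
    ⟨m (pluckerVec a b₂), m (pluckerVec b₁ a),
      a + (-m (pluckerVec a b₂)) • b₁ + (-m (pluckerVec b₁ a)) • b₂, by module,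
      by simp [-neg_smul, pluckerVec_add_right, pluckerVec_smul_right, hb, pluckerVec_self],
      by simp [-neg_smul, pluckerVec_add_left, pluckerVec_smul_left, hb, pluckerVec_self]⟩
  refine linearMap_eq_zero_of_pluckerVec fun a b => ?_
  obtain ⟨x, y, w, rfl, h1, h2⟩ := dec a
  obtain ⟨x', y', w', rfl, h1', h2'⟩ := dec b
  simp [-neg_smul, pluckerVec_add_left, pluckerVec_add_right, pluckerVec_smul_left, pluckerVec_smul_right,
    pluckerVec_self, k12, swap k b₁ b₂, hk1 w h1, hk2 w h2, swap k w' b₁, swap k w' b₂,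
    hk1 w' h1', hk2 w' h2', hkw w w' h1 h2 h1' h2']

end Plucker

section GushelMukai

theorem polyDiff_eq_zero_of_curve {m : ℕ} {p : MvPolynomial (Fin m) ℂ} {o a b : Fin m → ℂ}
    (h : ∀ s : ℂ, MvPolynomial.eval (o + s • a + s ^ 2 • b) p = 0) : polyDiff p o a = 0 := by
  have h1 := hasDerivAt_eval_comp p (γ := fun s : ℂ => o + s • a + s ^ 2 • b) (γ' := a) (s := 0)
    fun i => by
      have := (((hasDerivAt_id (0 : ℂ)).mul_const (a i)).const_add (o i)).fun_add
        (((hasDerivAt_id (0 : ℂ)).fun_pow 2).mul_const (b i))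
      simpa using this
  simp only [h] at h1
  simpa using h1.unique (hasDerivAt_const 0 0)

theorem mk_mem_coneOver_grass25 {m : ℕ} {f : (Fin 10 → ℂ) →ₗ[ℂ] (Fin m → ℂ)}
    {hf : Function.Injective f} {o : PS m} {v : Fin m → ℂ} (hv : v ≠ 0) :
    Projectivization.mk ℂ v hv ∈ ConeOver o (Projectivization.map f hf '' Grass25) ↔
      ∃ a b, ∃ u : ℂ, v = f (pluckerVec a b) + u • o.rep := by
  constructor
  · rintro (h | ⟨_, ⟨_, ⟨a, b, hab, rfl⟩, rfl⟩, hy⟩)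
    · have := rep_mem_submodule o
      rw [← h, Projectivization.submodule_mk] at this
      obtain ⟨c, hc⟩ := Submodule.mem_span_singleton.1 this
      have hc0 : c ≠ 0 := fun h0 => o.rep_nonzero (by rw [← h, ← hc, h0, zero_smul])
      refine ⟨0, 0, c⁻¹, ?_⟩
      rw [← h, ← hc, smul_smul, inv_mul_cancel₀ hc0, one_smul, pluckerVec_self, map_zero, zero_add]
    · rw [Projectivization.map_mk, Projectivization.submodule_mk, Projectivization.submodule_mk,
        Projectivization.submodule_eq, Submodule.span_singleton_le_iff_mem] at hy
      obtain ⟨_, h1, _, h2, rfl⟩ := Submodule.mem_sup.1 hy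
      obtain ⟨c, rfl⟩ := Submodule.mem_span_singleton.1 h1
      obtain ⟨d, rfl⟩ := Submodule.mem_span_singleton.1 h2
      exact ⟨d • a, b, c, by rw [pluckerVec_smul_left, map_smul, add_comm]⟩
  · rintro ⟨a, b, u, rfl⟩
    by_cases h : pluckerVec a b = 0
    · left
      refine (Projectivization.mk_eq_mk_iff' ℂ _ _ hv o.rep_nonzero).2 ⟨u, ?_⟩ |>.trans o.mk_rep
      rw [h, map_zero, zero_add]
    · right
      refine ⟨_, ⟨_, ⟨a, b, h, rfl⟩, rfl⟩, ?_⟩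
      rw [Projectivization.map_mk, Projectivization.submodule_mk, Projectivization.submodule_mk,
        Projectivization.submodule_eq, Submodule.span_singleton_le_iff_mem, add_comm]
      exact Submodule.add_mem_sup (Submodule.smul_mem _ _ (Submodule.mem_span_singleton_self _))
        (Submodule.mem_span_singleton_self _)

theorem pvanish_mk_iff {m : ℕ} {q : MvPolynomial (Fin m) ℂ}
    {B : (Fin m → ℂ) →ₗ[ℂ] (Fin m → ℂ) →ₗ[ℂ] ℂ} (hB : ∀ v, MvPolynomial.eval v q = B v v)
    {v : Fin m → ℂ} (hv : v ≠ 0) : PVanish q (Projectivization.mk ℂ v hv) ↔ B v v = 0 := by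
  constructor
  · intro h
    rw [← hB]
    exact h _ (by rw [Projectivization.submodule_mk]; exact Submodule.mem_span_singleton_self _)
  · intro h w hw
    rw [Projectivization.submodule_mk] at hw
    obtain ⟨c, rfl⟩ := Submodule.mem_span_singleton.1 hw
    rw [hB]
    simp [h]

/-- Smoothness prevents the quadric from passing through the vertex of the cone. -/
theorem vertex_not_mem_quadric {f : (Fin 10 → ℂ) →ₗ[ℂ] (Fin 11 → ℂ)} {hf : Function.Injective f}
    {o : PS 11} {q : MvPolynomial (Fin 11) ℂ} {B : (Fin 11 → ℂ) →ₗ[ℂ] (Fin 11 → ℂ) →ₗ[ℂ] ℂ}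
    (hs : ∀ v w, B v w = B w v) (hB : ∀ v, MvPolynomial.eval v q = B v v)
    (hm : ∃ A, B o.rep (f A) ≠ 0) {G : Set (PS 11)}
    (hG : G = ConeOver o (Projectivization.map f hf '' Grass25) ∩ {x | PVanish q x})
    (hsm : SmoothVariety G 6) : B o.rep o.rep ≠ 0 := by
  intro ho
  have hoG : o ∈ G := by
    rw [hG]
    refine ⟨Or.inl rfl, ?_⟩
    have := (pvanish_mk_iff hB o.rep_nonzero).2 ho
    rwa [o.mk_rep] at this
  have hvan : ∀ p : MvPolynomial (Fin 11) ℂ, (∀ y ∈ G, PVanish p y) → ∀ a b, ∀ u : ℂ,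
      B (f (pluckerVec a b) + u • o.rep) (f (pluckerVec a b) + u • o.rep) = 0 →
      MvPolynomial.eval (f (pluckerVec a b) + u • o.rep) p = 0 := by
    intro p hp a b u h0
    by_cases hv : f (pluckerVec a b) + u • o.rep = 0
    · rw [hv]
      exact hp o hoG 0 (zero_mem _)
    · refine hp (Projectivization.mk ℂ _ hv) ?_ _ ?_
      · rw [hG]
        exact ⟨(mk_mem_coneOver_grass25 hv).2 ⟨a, b, u, rfl⟩, (pvanish_mk_iff hB hv).2 h0⟩
      · rw [Projectivization.submodule_mk]; exact Submodule.mem_span_singleton_self _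
  have htan : ∀ p : MvPolynomial (Fin 11) ℂ, (∀ y ∈ G, PVanish p y) → ∀ a b,
      B o.rep (f (pluckerVec a b)) = 0 → (∃ a', B o.rep (f (pluckerVec a' b)) ≠ 0) →
      polyDiff p o.rep (f (pluckerVec a b)) = 0 := by
    rintro p hp a b h0 ⟨a', h1⟩
    have hoo : polyDiff p o.rep o.rep = 0 :=
      polyDiff_eq_zero_of_curve (b := 0) fun s => by
        have := hvan p hp 0 0 (1 + s) (by simp [pluckerVec_self, ho])
        refine (congrArg (fun v => MvPolynomial.eval v p) ?_).trans this
        rw [pluckerVec_self, map_zero]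
        module
    by_cases hA : B (f (pluckerVec a b)) (f (pluckerVec a b)) = 0
    · refine polyDiff_eq_zero_of_curve (b := 0) fun s => ?_
      have := hvan p hp (s • a) b 1 (by
        simp [pluckerVec_smul_left, hA, ho, h0, hs (f (pluckerVec a b)) o.rep])
      refine (congrArg (fun v => MvPolynomial.eval v p) ?_).trans this
      rw [pluckerVec_smul_left, map_smul]
      module
    · obtain ⟨k, hk⟩ : ∃ k, k = B (f (pluckerVec a b)) (f (pluckerVec a b)) := ⟨_, rfl⟩
      obtain ⟨c, hc⟩ : ∃ c, c = B o.rep (f (pluckerVec a' b)) := ⟨_, rfl⟩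
      obtain ⟨d, hd⟩ : ∃ d, d = B (f (pluckerVec a b)) (f (pluckerVec a' b)) := ⟨_, rfl⟩
      obtain ⟨e, he⟩ : ∃ e, e = B (f (pluckerVec a' b)) (f (pluckerVec a' b)) := ⟨_, rfl⟩
      rw [← hk] at hA
      rw [← hc] at h1
      have key := polyDiff_eq_zero_of_curve (p := p) (o := o.rep)
        (a := (-2 * c / k) • f (pluckerVec a b) + (2 * d / k) • o.rep)
        (b := (-2 * c / k) • f (pluckerVec a' b) + (e / k) • o.rep) fun s => by
          have := hvan p hp ((-2 * c / k * s) • (a + s • a')) b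
            (1 + s * (2 * d / k) + s ^ 2 * (e / k)) (by
              simp only [pluckerVec_smul_left, pluckerVec_add_left, map_add, map_smul,
                LinearMap.add_apply, LinearMap.smul_apply, smul_eq_mul,
                hs (f (pluckerVec a b)) o.rep, hs (f (pluckerVec a' b)) o.rep,
                hs (f (pluckerVec a' b)) (f (pluckerVec a b)), h0, ho, ← hk, ← hc, ← hd, ← he]
              field_simp
              ring)
          refine (congrArg (fun v => MvPolynomial.eval v p) ?_).trans this
          rw [pluckerVec_smul_left, pluckerVec_add_left, pluckerVec_smul_left, map_smul,
            map_add, map_smul]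
          module
      rw [map_add, map_smul, map_smul, hoo, smul_zero, add_zero, smul_eq_zero] at key
      exact key.resolve_left (div_ne_zero (mul_ne_zero (by norm_num) h1) hA)
  obtain ⟨A₀, hA₀⟩ := hm
  have hm0 : (B o.rep).comp f ≠ 0 := fun h => hA₀ (LinearMap.congr_fun h A₀)
  have hle : (LinearMap.ker ((B o.rep).comp f)).map f ≤ tangentSubmodule G o := by
    rintro _ ⟨A, hA, rfl⟩
    by_contra hnot
    obtain ⟨l, hl, hlT⟩ := Submodule.exists_le_ker_of_notMem hnot
    obtain ⟨c, hc⟩ := exists_eq_smul_of_pluckerVec (l := l.comp f) hm0 fun a b h1 h2 => by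
      refine hlT ?_
      simp only [tangentSubmodule, Submodule.mem_iInf, LinearMap.mem_ker]
      exact fun p hp => htan p hp a b h1 h2
    refine hl ?_
    have h3 : l (f A) = c * B o.rep (f A) := LinearMap.congr_fun hc A
    have h4 : B o.rep (f A) = 0 := hA
    rw [h3, h4, mul_zero]
  have h1 := Submodule.finrank_mono hle
  rw [hsm.2.2.2 o hoG, ← (Submodule.equivMapOfInjective f hf _).finrank_eq] at h1
  have h2 := ((B o.rep).comp f).finrank_range_add_finrank_ker
  have h3 := Submodule.finrank_le (LinearMap.range ((B o.rep).comp f))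
  simp at h2 h3
  omega

theorem PaperQV.IsGushelMukai6.exists_coordinates {G : Set (PS 11)} (hG : IsGushelMukai6 G) :
    ∃ (φ : (Fin 10 → ℂ) →ₗ[ℂ] (Fin 11 → ℂ)) (o : Fin 11 → ℂ)
      (q : (Fin 10 → ℂ) →ₗ[ℂ] (Fin 10 → ℂ) →ₗ[ℂ] ℂ) (κ : ℂ), κ ≠ 0 ∧
      (∀ A C, q A C = q C A) ∧ (∃ a b, q (pluckerVec a b) (pluckerVec a b) ≠ 0) ∧
      (∀ v, ∃ A, ∃ u : ℂ, v = φ A + u • o) ∧ (∀ A (u : ℂ), φ A + u • o = 0 → A = 0 ∧ u = 0) ∧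
      ∀ A (u : ℂ) (h : φ A + u • o ≠ 0), Projectivization.mk ℂ _ h ∈ G ↔
        (∃ a b, A = pluckerVec a b) ∧ κ * u ^ 2 + q A A = 0 := by
  obtain ⟨f, hf, o, q, ho, hq2, hns, hGeq, hsm⟩ := hG
  obtain ⟨B, hs, hB⟩ := exists_bilin_of_isHomogeneous_two q hq2
  have hrad : ∀ v, (∀ w, B v w = 0) → v = 0 := fun v hv => by
    refine hns v (by rw [hB, hv]) fun j => ?_
    have := polyDiff_apply_of_eval_eq hs hB v (Pi.single j 1)
    rw [hv, mul_zero, polyDiff_apply_eq_sum] at this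
    simpa [Pi.single_apply] using this
  have hor : o.rep ∉ LinearMap.range f := fun h => ho (by
    rw [Projectivization.submodule_eq, Submodule.span_singleton_le_iff_mem]; exact h)
  have hinj0 : ∀ A (u : ℂ), f A + u • o.rep = 0 → A = 0 ∧ u = 0 := by
    intro A u h
    have hu : u = 0 := by
      by_contra hu
      refine hor ⟨-u⁻¹ • A, ?_⟩
      rw [map_smul, eq_neg_of_add_eq_zero_left h]
      simp [smul_smul, inv_mul_cancel₀ hu]
    rw [hu, zero_smul, add_zero] at h
    exact ⟨hf (h.trans (map_zero f).symm), hu⟩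
  have hsurj0 : ∀ v, ∃ A, ∃ u : ℂ, v = f A + u • o.rep := by
    let g : ((Fin 10 → ℂ) × ℂ) →ₗ[ℂ] (Fin 11 → ℂ) :=
      f.coprod (LinearMap.toSpanSingleton ℂ _ o.rep)
    have hg : Function.Injective g := by
      rw [injective_iff_map_eq_zero]
      rintro ⟨A, u⟩ h
      have := hinj0 A u (by simpa [g] using h)
      simp [this]
    have hg' : Function.Surjective g :=
      (LinearMap.injective_iff_surjective_of_finrank_eq_finrank (by simp)).1 hg
    intro v
    obtain ⟨⟨A, u⟩, h⟩ := hg' v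
    exact ⟨A, u, by rw [← h]; simp [g]⟩
  have hκ : B o.rep o.rep ≠ 0 := by
    by_cases hm : ∃ A, B o.rep (f A) ≠ 0
    · exact vertex_not_mem_quadric hs hB hm hGeq hsm
    · push Not at hm
      intro h0
      refine o.rep_nonzero (hrad _ fun w => ?_)
      obtain ⟨A, u, rfl⟩ := hsurj0 w
      simp [hm, h0]
  obtain ⟨κ, hκ'⟩ : ∃ κ, κ = B o.rep o.rep := ⟨_, rfl⟩
  rw [← hκ'] at hκ
  let φ : (Fin 10 → ℂ) →ₗ[ℂ] (Fin 11 → ℂ) :=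
    f - (LinearMap.toSpanSingleton ℂ _ o.rep).comp (κ⁻¹ • (B o.rep).comp f)
  have hφ : ∀ A, φ A = f A - (κ⁻¹ * B o.rep (f A)) • o.rep := fun A => by simp [φ]
  have hφo : ∀ A, B o.rep (φ A) = 0 := fun A => by
    rw [hφ, map_sub, map_smul, ← hκ', smul_eq_mul]
    field_simp
    ring
  have hadd : ∀ A (u : ℂ), φ A + u • o.rep = f A + (u - κ⁻¹ * B o.rep (f A)) • o.rep :=
    fun A u => by rw [hφ]; module
  have hsurj : ∀ v, ∃ A, ∃ u : ℂ, v = φ A + u • o.rep := fun v => by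
    obtain ⟨A, u, h⟩ := hsurj0 v
    exact ⟨A, u + κ⁻¹ * B o.rep (f A), by rw [hadd, h]; congr 2; ring⟩
  have hinj : ∀ A (u : ℂ), φ A + u • o.rep = 0 → A = 0 ∧ u = 0 := fun A u h => by
    rw [hadd] at h
    obtain ⟨h1, h2⟩ := hinj0 _ _ h
    subst h1
    exact ⟨rfl, by simpa using h2⟩
  refine ⟨φ, o.rep, B.compl₁₂ φ φ, κ, hκ, fun A C => hs _ _, ?_, hsurj, hinj, ?_⟩
  · by_contra! h
    obtain ⟨n, hn⟩ := exists_eq_sum_pfaffPolar (β := B.compl₁₂ φ φ) (fun A C => hs _ _) h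
    obtain ⟨A, hA, hAC⟩ := exists_sum_mul_pfaffPolar_eq_zero n
    refine hA (hinj A 0 ?_).1
    rw [zero_smul, add_zero]
    refine hrad _ fun w => ?_
    obtain ⟨C, u, rfl⟩ := hsurj w
    have h1 : B (φ A) (φ C) = 0 := by
      have := hn A C
      simp only [smul_eq_mul, mul_comm _ (n _), hAC] at this
      exact this
    rw [map_add, map_smul, h1, hs, hφo, smul_zero, add_zero]
  · intro A u h
    have h1 : B (φ A + u • o.rep) (φ A + u • o.rep) = κ * u ^ 2 + B (φ A) (φ A) := by
      simp [hs (φ A) o.rep, hφo, ← hκ']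
      ring
    rw [hGeq, Set.mem_inter_iff, mk_mem_coneOver_grass25, Set.mem_ofPred_eq, pvanish_mk_iff hB, h1]
    refine and_congr_left fun _ => ⟨?_, ?_⟩
    · rintro ⟨a, b, u', h2⟩
      rw [hadd] at h2
      refine ⟨a, b, sub_eq_zero.1 (hinj0 (A - pluckerVec a b) (u - κ⁻¹ * B o.rep (f A) - u') ?_).1⟩
      rw [map_sub, sub_smul, ← sub_eq_zero.2 h2]
      abel
    · rintro ⟨a, b, rfl⟩
      exact ⟨a, b, _, hadd _ _⟩

end GushelMukai

section LinesThroughPoint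

variable {m c : ℕ} {D : (Fin m → ℂ) →ₗ[ℂ] (Fin m → ℂ) →ₗ[ℂ] (Fin c → ℂ)} {X : Set (PS m)}

theorem mk_mem_iff_of_system (hX : ∀ x : PS m, x ∈ X ↔ D x.rep x.rep = 0) {v : Fin m → ℂ}
    (hv : v ≠ 0) : Projectivization.mk ℂ v hv ∈ X ↔ D v v = 0 := by
  rw [hX]
  obtain ⟨a, ha⟩ := Projectivization.exists_smul_eq_mk_rep ℂ v hv
  rw [← ha, Units.smul_def]
  simp

theorem lineThrough_subset_iff (hs : ∀ v w, D v w = D w v)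
    (hX : ∀ x : PS m, x ∈ X ↔ D x.rep x.rep = 0) {x : PS m} (hx : x ∈ X) {v : Fin m → ℂ}
    (hv : v ≠ 0) (hxv : D x.rep v = 0) : LineThrough x v ⊆ X ↔ D v v = 0 := by
  constructor
  · intro h
    rw [← mk_mem_iff_of_system hX hv]
    refine h ?_
    rw [LineThrough, Set.mem_ofPred_eq, Projectivization.submodule_mk]
    exact le_sup_right
  · intro h y hy
    have := hy (rep_mem_submodule y)
    rw [Projectivization.submodule_eq x, Submodule.mem_sup] at this
    obtain ⟨_, h1, _, h2, h3⟩ := this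
    obtain ⟨a, rfl⟩ := Submodule.mem_span_singleton.1 h1
    obtain ⟨b, rfl⟩ := Submodule.mem_span_singleton.1 h2
    rw [hX, ← h3]
    simp [h, hxv, hs v x.rep, (hX x).1 hx]

/-- Adapted coordinates on the tangent space at a point whose variety of lines is a
Gushel–Mukai sixfold: `o` is the direction of the vertex and `τ` parametrizes the `q`-orthogonal
copy of the Plücker space. -/
structure GMFrame (D : (Fin m → ℂ) →ₗ[ℂ] (Fin m → ℂ) →ₗ[ℂ] (Fin c → ℂ)) (x : Fin m → ℂ) where
  τ : (Fin 10 → ℂ) →ₗ[ℂ] (Fin m → ℂ)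
  o : Fin m → ℂ
  q : (Fin 10 → ℂ) →ₗ[ℂ] (Fin 10 → ℂ) →ₗ[ℂ] ℂ
  κ : ℂ
  κ_ne_zero : κ ≠ 0
  q_symm : ∀ A C, q A C = q C A
  q_ne_zero : ∃ a b, q (pluckerVec a b) (pluckerVec a b) ≠ 0
  apply_eq_zero : ∀ A (u : ℂ), D x (τ A + u • o) = 0
  exists_eq : ∀ w, D x w = 0 → ∃ s : ℂ, ∃ A, ∃ u : ℂ, w = s • x + (τ A + u • o)
  eq_zero : ∀ (s : ℂ) A (u : ℂ), s • x + (τ A + u • o) = 0 → s = 0 ∧ A = 0 ∧ u = 0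
  isotropic_iff : ∀ A (u : ℂ), D (τ A + u • o) (τ A + u • o) = 0 ↔
    (∃ a b, A = pluckerVec a b) ∧ κ * u ^ 2 + q A A = 0

theorem PaperQV.IsVMRTModel.nonempty_gmFrame (hs : ∀ v w, D v w = D w v)
    (hX : ∀ x : PS m, x ∈ X ↔ D x.rep x.rep = 0) {x : PS m} (hx : x ∈ X)
    (htan : tangentSubmodule X x = LinearMap.ker (D x.rep)) {W : Set (PS 11)}
    (hW : IsVMRTModel X x W) {G : Set (PS 11)} (hG : IsGushelMukai6 G) (hWG : ProjEquiv W G) :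
    Nonempty (GMFrame D x.rep) := by
  obtain ⟨j, hj, hjx, hjT, rfl⟩ := hW
  obtain ⟨g, hg, hg', hgG⟩ := hWG
  obtain ⟨φ, o, q, κ, hκ, hq, hq0, hsurj, hinj, hmem⟩ := hG.exists_coordinates
  let e := LinearEquiv.ofBijective g ⟨hg, hg'⟩
  let J : (Fin 11 → ℂ) →ₗ[ℂ] (Fin m → ℂ) := j.comp (e.symm : (Fin 11 → ℂ) →ₗ[ℂ] (Fin 11 → ℂ))
  have hJ : ∀ v, J v = j (e.symm v) := fun v => rfl
  have hJinj : Function.Injective J := hj.comp e.symm.injective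
  have hDJ : ∀ v, D x.rep (J v) = 0 := fun v => by
    rw [← LinearMap.mem_ker, ← htan, ← hjT]
    exact Submodule.mem_sup_left ⟨_, rfl⟩
  have hiso : ∀ v (hv : v ≠ 0), D (J v) (J v) = 0 ↔ Projectivization.mk ℂ v hv ∈ G := by
    intro v hv
    have hw : e.symm v ≠ 0 := fun h => hv (by simpa using h)
    have h1 : Projectivization.map g hg (Projectivization.mk ℂ (e.symm v) hw)
        = Projectivization.mk ℂ v hv := by
      rw [Projectivization.map_mk]
      congr 1
      exact e.apply_symm_apply v
    rw [← h1, ← hgG, (Projectivization.map_injective g hg).mem_set_image, Set.mem_ofPred_eq,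
      lineThrough_subset_iff hs hX hx]
    · obtain ⟨a, ha⟩ := Projectivization.exists_smul_eq_mk_rep ℂ (e.symm v) hw
      rw [← ha, Units.smul_def, map_smul, ← hJ]
      simp
    · rw [Ne, map_eq_zero_iff j hj]
      exact Projectivization.rep_nonzero _
    · rw [← e.symm_apply_apply (Projectivization.rep _), ← hJ, hDJ]
  refine ⟨⟨J.comp φ, J o, q, κ, hκ, hq, hq0, fun A u => ?_, fun w hw => ?_, fun s A u h => ?_,
    fun A u => ?_⟩⟩
  · rw [LinearMap.comp_apply, ← map_smul, ← map_add, hDJ]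
  · rw [← LinearMap.mem_ker, ← htan, ← hjT, Submodule.mem_sup] at hw
    obtain ⟨_, ⟨v, rfl⟩, y, hy, rfl⟩ := hw
    rw [Projectivization.submodule_eq] at hy
    obtain ⟨s, rfl⟩ := Submodule.mem_span_singleton.1 hy
    obtain ⟨A, u, h⟩ := hsurj (e v)
    refine ⟨s, A, u, ?_⟩
    rw [LinearMap.comp_apply, ← map_smul, ← map_add, ← h, hJ, e.symm_apply_apply, add_comm]
  · rw [LinearMap.comp_apply, ← map_smul, ← map_add] at h
    have h1 : J (φ A + u • o) = 0 := by
      have h2 : J (φ A + u • o) ∈ LinearMap.range j ⊓ x.submodule := by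
        refine ⟨⟨_, rfl⟩, ?_⟩
        rw [eq_neg_of_add_eq_zero_right h, Projectivization.submodule_eq]
        exact neg_mem (Submodule.smul_mem _ _ (Submodule.mem_span_singleton_self _))
      rwa [hjx, Submodule.mem_bot] at h2
    obtain ⟨h2, h3⟩ := hinj _ _ ((map_eq_zero_iff J hJinj).1 h1)
    rw [h1, add_zero] at h
    exact ⟨(smul_eq_zero.1 h).resolve_right x.rep_nonzero, h2, h3⟩
  · rw [LinearMap.comp_apply, ← map_smul, ← map_add]
    by_cases hv : φ A + u • o = 0
    · obtain ⟨rfl, rfl⟩ := hinj _ _ hv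
      exact iff_of_true (by simp) ⟨⟨0, 0, (pluckerVec_self 0).symm⟩, by simp⟩
    · rw [hiso _ hv, hmem]

end LinesThroughPoint

section Normals

theorem eq_zero_of_add_of_sub {F : Type*} [AddCommGroup F] [Module ℂ F] {a b : F}
    (h₁ : a + b = 0) (h₂ : a - b = 0) : a = 0 ∧ b = 0 := by
  obtain rfl := sub_eq_zero.1 h₂
  rw [← two_smul ℂ] at h₁
  have := (smul_eq_zero.1 h₁).resolve_left two_ne_zero
  exact ⟨this, this⟩

variable {m c : ℕ} {D : (Fin m → ℂ) →ₗ[ℂ] (Fin m → ℂ) →ₗ[ℂ] (Fin c → ℂ)} {x : Fin m → ℂ}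

/-- The second fundamental form in a Gushel–Mukai frame is the system of quadrics
through the Gushel–Mukai sixfold. -/
theorem GMFrame.exists_normals (fr : GMFrame D x) (hs : ∀ v w, D v w = D w v) :
    ∃ (n : Fin 5 → Fin c → ℂ) (n₅ : Fin c → ℂ), (∀ A C (u u' : ℂ),
      D (fr.τ A + u • fr.o) (fr.τ C + u' • fr.o) =
        ∑ k, pfaffPolar A C k • n k + (fr.κ * (u * u') + fr.q A C) • n₅) ∧
      ∀ (r : Fin 5 → ℂ) (r₅ : ℂ), ∑ k, r k • n k + r₅ • n₅ = 0 → r = 0 ∧ r₅ = 0 := by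
  have hsqrt : ∀ z : ℂ, ∃ u : ℂ, fr.κ * u ^ 2 = z := fun z => by
    obtain ⟨u, hu⟩ := IsAlgClosed.exists_pow_nat_eq (z / fr.κ) two_pos
    exact ⟨u, by rw [hu, mul_div_cancel₀ _ fr.κ_ne_zero]⟩
  obtain ⟨n₅, hn₅⟩ : ∃ n₅, D fr.o fr.o = fr.κ • n₅ :=
    ⟨fr.κ⁻¹ • D fr.o fr.o, by rw [smul_smul, mul_inv_cancel₀ fr.κ_ne_zero, one_smul]⟩
  let φ : (Fin 10 → ℂ) →ₗ[ℂ] (Fin 10 → ℂ) →ₗ[ℂ] (Fin c → ℂ) :=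
    D.compl₁₂ fr.τ fr.τ - fr.q.compr₂ (LinearMap.toSpanSingleton ℂ _ n₅)
  have hφ : ∀ A C, φ A C = D (fr.τ A) (fr.τ C) - fr.q A C • n₅ := fun A C => by simp [φ]
  have hexp : ∀ A C (u u' : ℂ), D (fr.τ A + u • fr.o) (fr.τ C + u' • fr.o) =
      φ A C + u • D fr.o (fr.τ C) + u' • D fr.o (fr.τ A)
        + (fr.κ * (u * u') + fr.q A C) • n₅ := fun A C u u' => by
    rw [hφ]
    simp only [map_add, map_smul, LinearMap.add_apply, LinearMap.smul_apply, hn₅,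
      hs (fr.τ A) fr.o]
    module
  have hvan : ∀ a b (u : ℂ), fr.κ * u ^ 2 = - fr.q (pluckerVec a b) (pluckerVec a b) →
      φ (pluckerVec a b) (pluckerVec a b) + (2 * u) • D fr.o (fr.τ (pluckerVec a b)) = 0 := by
    intro a b u hu
    have := (fr.isotropic_iff (pluckerVec a b) u).2 ⟨⟨a, b, rfl⟩, by rw [hu]; ring⟩
    rw [hexp, ← sq, hu, neg_add_cancel, zero_smul, add_zero] at this
    rw [← this]
    module
  have hvan2 : ∀ a b, ∃ u : ℂ, fr.κ * u ^ 2 = - fr.q (pluckerVec a b) (pluckerVec a b) ∧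
      φ (pluckerVec a b) (pluckerVec a b) = 0 ∧ u • D fr.o (fr.τ (pluckerVec a b)) = 0 := by
    intro a b
    obtain ⟨u, hu⟩ := hsqrt (- fr.q (pluckerVec a b) (pluckerVec a b))
    have h1 := hvan a b u hu
    have h2 := hvan a b (-u) (by rw [← hu]; ring)
    obtain ⟨h3, h4⟩ := eq_zero_of_add_of_sub h1 (by rw [← h2]; module)
    exact ⟨u, hu, h3, by simpa [mul_smul] using h4⟩
  have hm : (D fr.o).comp fr.τ = 0 :=
    linearMap_eq_zero_of_generic_pluckerVec fr.q_ne_zero fun a b hab => by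
      obtain ⟨u, hu, -, h⟩ := hvan2 a b
      refine (smul_eq_zero.1 h).resolve_left fun h0 => hab ?_
      simpa [h0] using hu.symm
  have hm' : ∀ A, D fr.o (fr.τ A) = 0 := fun A => LinearMap.congr_fun hm A
  obtain ⟨n, hn⟩ := exists_eq_sum_pfaffPolar (β := φ)
    (fun A C => by rw [hφ, hφ, hs, fr.q_symm]) fun a b => (hvan2 a b).choose_spec.2.1
  have hmain : ∀ A C (u u' : ℂ), D (fr.τ A + u • fr.o) (fr.τ C + u' • fr.o) =
      ∑ k, pfaffPolar A C k • n k + (fr.κ * (u * u') + fr.q A C) • n₅ := fun A C u u' => by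
    rw [hexp, hm', hm', hn, smul_zero, smul_zero, add_zero, add_zero]
  refine ⟨n, n₅, hmain, fun r r₅ h => ?_⟩
  obtain ⟨A, hA⟩ := exists_pfaffPolar_self_eq r
  obtain ⟨u, hu⟩ := hsqrt (r₅ - fr.q A A)
  have hr₅ : fr.κ * u ^ 2 + fr.q A A = r₅ := by rw [hu]; ring
  rw [← hA, ← hr₅, sq, ← hmain, fr.isotropic_iff] at h
  obtain ⟨⟨a, b, rfl⟩, h5⟩ := h
  exact ⟨by rw [← hA, pfaffPolar_pluckerVec], by rw [← hr₅, h5]⟩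

end Normals

section Plucker

theorem eq_zero_of_sum_pfaffPolar_mul {M : Fin 5 → ℂ}
    (h : ∀ a b C j, ∑ k, pfaffPolar C (pluckerVec a b) k * (pluckerVec a b j * M k) = 0) :
    M = 0 := by
  have h1 : ∀ i j l : Fin 10, ∑ k, pfaffPolar (Pi.single j 1) (Pi.single i 1) k *
      ((Pi.single i 1 : Fin 10 → ℂ) l * M k) = 0 := fun i j l => by
    rw [single_eq_pluckerVec i]; exact h _ _ _ _
  ext k
  fin_cases k
  · simpa [pfaffPolar_apply, Fin.sum_univ_five] using h1 4 9 4
  · simpa [pfaffPolar_apply, Fin.sum_univ_five] using h1 1 9 1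
  · simpa [pfaffPolar_apply, Fin.sum_univ_five] using h1 0 9 0
  · simpa [pfaffPolar_apply, Fin.sum_univ_five] using h1 0 8 0
  · simpa [pfaffPolar_apply, Fin.sum_univ_five] using h1 0 7 0

theorem exists_eq_smul_one_of_sum_pfaffPolar_mul {M : Matrix (Fin 5) (Fin 5) ℂ}
    (h : ∀ a b C j, ∑ k, pfaffPolar C (pluckerVec a b) k *
      ∑ i, skewMat (pluckerVec a b) j i * M i k = 0) : ∃ r : ℂ, M = r • 1 := by
  have key : ∀ i k : Fin 5, i < k → ∃ p, p ≠ i ∧ p ≠ k ∧ ∀ y : Fin 5 → ℂ, y p = 0 →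
      y i * ∑ l, y l * M l k = y k * ∑ l, y l * M l i := by
    have h' : ∀ (p : Fin 5) (l : Fin 10) (y : Fin 5 → ℂ), y p = 0 →
        ∑ k, pfaffPolar (Pi.single l 1) (pluckerVec (Pi.single p 1) y) k *
          ∑ i, y i * M i k = 0 := fun p l y hy => by
      refine Eq.trans ?_ (h (Pi.single p 1) y (Pi.single l 1) p)
      simp only [skewMat_pluckerVec, hy, mul_zero, sub_zero, Pi.single_eq_same, one_mul]
    intro i k hik
    obtain ⟨p, l, hpi, hpk, hpl⟩ : ∃ (p : Fin 5) (l : Fin 10), p ≠ i ∧ p ≠ k ∧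
        ∀ y z : Fin 5 → ℂ, y p = 0 →
          (∑ k, pfaffPolar (Pi.single l 1) (pluckerVec (Pi.single p 1) y) k * z k
            = y i * z k - y k * z i ∨
          ∑ k, pfaffPolar (Pi.single l 1) (pluckerVec (Pi.single p 1) y) k * z k
            = y k * z i - y i * z k) := by
      match i, k, hik with
      | 0, 1, _ => exact ⟨2, 9, by decide, by decide, fun y z hy => by
          simp [pfaffPolar_apply, Fin.sum_univ_five, pluckerVec, pluckerPair, hy]
          exact Or.inl (by ring)⟩
      | 0, 2, _ => exact ⟨1, 9, by decide, by decide, fun y z hy => by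
          simp [pfaffPolar_apply, Fin.sum_univ_five, pluckerVec, pluckerPair, hy]
          exact Or.inr (by ring)⟩
      | 0, 3, _ => exact ⟨1, 8, by decide, by decide, fun y z hy => by
          simp [pfaffPolar_apply, Fin.sum_univ_five, pluckerVec, pluckerPair, hy]
          exact Or.inl (by ring)⟩
      | 0, 4, _ => exact ⟨1, 7, by decide, by decide, fun y z hy => by
          simp [pfaffPolar_apply, Fin.sum_univ_five, pluckerVec, pluckerPair, hy]
          exact Or.inr (by ring)⟩
      | 1, 2, _ => exact ⟨0, 9, by decide, by decide, fun y z hy => by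
          simp [pfaffPolar_apply, Fin.sum_univ_five, pluckerVec, pluckerPair, hy]
          exact Or.inl (by ring)⟩
      | 1, 3, _ => exact ⟨0, 8, by decide, by decide, fun y z hy => by
          simp [pfaffPolar_apply, Fin.sum_univ_five, pluckerVec, pluckerPair, hy]
          exact Or.inr (by ring)⟩
      | 1, 4, _ => exact ⟨0, 7, by decide, by decide, fun y z hy => by
          simp [pfaffPolar_apply, Fin.sum_univ_five, pluckerVec, pluckerPair, hy]
          exact Or.inl (by ring)⟩
      | 2, 3, _ => exact ⟨0, 6, by decide, by decide, fun y z hy => by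
          simp [pfaffPolar_apply, Fin.sum_univ_five, pluckerVec, pluckerPair, hy]
          exact Or.inl (by ring)⟩
      | 2, 4, _ => exact ⟨0, 5, by decide, by decide, fun y z hy => by
          simp [pfaffPolar_apply, Fin.sum_univ_five, pluckerVec, pluckerPair, hy]
          exact Or.inr (by ring)⟩
      | 3, 4, _ => exact ⟨0, 4, by decide, by decide, fun y z hy => by
          simp [pfaffPolar_apply, Fin.sum_univ_five, pluckerVec, pluckerPair, hy]
          exact Or.inl (by ring)⟩
      | 4, k, hik => exact absurd hik (not_lt.2 (Fin.le_last k))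
    refine ⟨p, hpi, hpk, fun y hy => ?_⟩
    have h1 := h' p l y hy
    rcases hpl y (fun k => ∑ i, y i * M i k) hy with h2 | h2
    · exact sub_eq_zero.1 (h2 ▸ h1)
    · exact (sub_eq_zero.1 (h2 ▸ h1)).symm
  have off : ∀ i k, i < k → M i k = 0 ∧ M k i = 0 := fun i k hik => by
    obtain ⟨p, hpi, hpk, hp⟩ := key i k hik
    have h1 := hp (Pi.single i 1) (by simp [hpi])
    have h2 := hp (Pi.single k 1) (by simp [hpk])
    constructor
    · simpa [Pi.single_apply, hik.ne, hik.ne'] using h1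
    · simpa [Pi.single_apply, hik.ne, hik.ne'] using h2.symm
  have diag : ∀ i k, i < k → M k k = M i i := fun i k hik => by
    obtain ⟨p, hpi, hpk, hp⟩ := key i k hik
    have h1 := hp (Pi.single i 1 + Pi.single k 1) (by simp [hpi, hpk])
    simpa [Pi.single_apply, hik.ne, hik.ne', add_mul, Finset.sum_add_distrib,
      off i k hik] using h1
  refine ⟨M 0 0, Matrix.ext fun i k => ?_⟩
  rcases lt_trichotomy i k with hik | rfl | hik
  · simp [hik.ne, off i k hik]
  · rcases (Fin.zero_le i).eq_or_lt with rfl | hi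
    · simp
    · simp [diag 0 i hi]
  · simp [hik.ne', off k i hik]

end Plucker

section GoodVector

variable {m c : ℕ} {D : (Fin m → ℂ) →ₗ[ℂ] (Fin m → ℂ) →ₗ[ℂ] (Fin c → ℂ)} {x : Fin m → ℂ}

/-- Coordinates on the tangent space, projecting to the Plücker factor. -/
theorem GMFrame.exists_projection (fr : GMFrame D x) :
    ∃ π : (Fin m → ℂ) →ₗ[ℂ] (Fin 10 → ℂ), ∀ (s : ℂ) A (u : ℂ),
      π (s • x + (fr.τ A + u • fr.o)) = A := by
  let f : (ℂ × (Fin 10 → ℂ) × ℂ) →ₗ[ℂ] (Fin m → ℂ) :=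
    (LinearMap.toSpanSingleton ℂ _ x).coprod
      (fr.τ.coprod (LinearMap.toSpanSingleton ℂ _ fr.o))
  have hf : ∀ s A u, f (s, A, u) = s • x + (fr.τ A + u • fr.o) := fun s A u => by simp [f]
  obtain ⟨g, hg⟩ := f.exists_leftInverse_of_injective (LinearMap.ker_eq_bot'.2 (by
    rintro ⟨s, A, u⟩ h
    rw [hf] at h
    obtain ⟨rfl, rfl, rfl⟩ := fr.eq_zero s A u h
    rfl))
  refine ⟨(LinearMap.fst ℂ _ _).comp ((LinearMap.snd ℂ _ _).comp g), fun s A u => ?_⟩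
  have := LinearMap.congr_fun hg (s, A, u)
  rw [LinearMap.comp_apply, hf] at this
  simp [this]

/-- The normals of a Gushel–Mukai frame form a basis of the conormal image of `D x`. -/
theorem GMFrame.exists_conormal_basis (fr : GMFrame D x) (hs : ∀ v w, D v w = D w v)
    (hrange : ∀ v w, D x v = 0 → D x w = 0 → D v w ∈ LinearMap.range (D x))
    (hrk : Module.finrank ℂ (LinearMap.range (D x)) = 6) :
    ∃ (n : Fin 5 → Fin c → ℂ) (n₅ : Fin c → ℂ), (∀ A C (u u' : ℂ),
      D (fr.τ A + u • fr.o) (fr.τ C + u' • fr.o) =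
        ∑ k, pfaffPolar A C k • n k + (fr.κ * (u * u') + fr.q A C) • n₅) ∧
      n₅ ≠ 0 ∧ (∀ k, n k ∈ LinearMap.range (D x)) ∧ n₅ ∈ LinearMap.range (D x) ∧
      (∀ y ∈ LinearMap.range (D x), ∃ (r : Fin 5 → ℂ) (r₅ : ℂ), y = ∑ k, r k • n k + r₅ • n₅) ∧
      ∃ ν : Fin 5 → Module.Dual ℂ (Fin c → ℂ), (∀ i j, ν i (n j) = if i = j then 1 else 0) ∧
        ∀ i, ν i n₅ = 0 := by
  obtain ⟨n, n₅, hform, hind⟩ := fr.exists_normals hs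
  let ψ : ((Fin 5 → ℂ) × ℂ) →ₗ[ℂ] (Fin c → ℂ) :=
    (Fintype.linearCombination ℂ n).coprod (LinearMap.toSpanSingleton ℂ _ n₅)
  have hψ : ∀ r r₅, ψ (r, r₅) = ∑ k, r k • n k + r₅ • n₅ := fun r r₅ => by
    simp [ψ, Fintype.linearCombination_apply]
  have hker : LinearMap.ker ψ = ⊥ := LinearMap.ker_eq_bot'.2 (by
    rintro ⟨r, r₅⟩ h
    rw [hψ] at h
    obtain ⟨rfl, rfl⟩ := hind r r₅ h
    rfl)
  have hmem : ∀ A C (u u' : ℂ), ∑ k, pfaffPolar A C k • n k + (fr.κ * (u * u') + fr.q A C) • n₅ ∈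
      LinearMap.range (D x) := fun A C u u' => by
    rw [← hform]
    exact hrange _ _ (fr.apply_eq_zero _ _) (fr.apply_eq_zero _ _)
  have h₅ : n₅ ∈ LinearMap.range (D x) := by
    have := hmem 0 0 1 1
    simp only [map_zero, Pi.zero_apply, zero_smul, Finset.sum_const_zero, mul_one, add_zero,
      zero_add] at this
    exact (Submodule.smul_mem_iff _ fr.κ_ne_zero).1 this
  have hn : ∀ k, n k ∈ LinearMap.range (D x) := fun k => by
    obtain ⟨A, hA⟩ := exists_pfaffPolar_self_eq (Pi.single k 1)
    have := hmem A A 0 0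
    rw [hA, Submodule.add_mem_iff_left _ (Submodule.smul_mem _ _ h₅)] at this
    simpa [Pi.single_apply] using this
  have hle : LinearMap.range ψ ≤ LinearMap.range (D x) := by
    rintro _ ⟨⟨r, r₅⟩, rfl⟩
    rw [hψ]
    exact add_mem (sum_mem fun k _ => Submodule.smul_mem _ _ (hn k)) (Submodule.smul_mem _ _ h₅)
  have heq : LinearMap.range ψ = LinearMap.range (D x) :=
    Submodule.eq_of_le_of_finrank_eq hle (by
      rw [hrk, LinearMap.finrank_range_of_inj (LinearMap.ker_eq_bot.1 hker)]
      simp)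
  obtain ⟨g, hg⟩ := ψ.exists_leftInverse_of_injective hker
  have hg' : ∀ r r₅, g (∑ k, r k • n k + r₅ • n₅) = (r, r₅) := fun r r₅ => by
    rw [← hψ]
    exact LinearMap.congr_fun hg (r, r₅)
  refine ⟨n, n₅, hform, ?_, hn, h₅, fun y hy => ?_, fun i => (LinearMap.proj i).comp
    ((LinearMap.fst ℂ _ _).comp g), fun i j => ?_, fun i => ?_⟩
  · rintro rfl
    simpa using (hind 0 1 (by simp)).2
  · obtain ⟨⟨r, r₅⟩, rfl⟩ := heq ▸ hy
    exact ⟨r, r₅, hψ r r₅⟩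
  · have := hg' (Pi.single j 1) 0
    simp only [Pi.single_apply, ite_smul, one_smul, zero_smul, Finset.sum_ite_eq',
      Finset.mem_univ, if_true, add_zero] at this
    simp [this, Pi.single_apply]
  · have := hg' 0 1
    simp only [Pi.zero_apply, zero_smul, Finset.sum_const_zero, zero_add, one_smul] at this
    simp [this]

end GoodVector

section GoodVector

variable {m c : ℕ} {D : (Fin m → ℂ) →ₗ[ℂ] (Fin m → ℂ) →ₗ[ℂ] (Fin c → ℂ)} {x : Fin m → ℂ}

/-- Liftable syzygies constrain the derivative of the normals in the vertex direction. -/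
theorem GMFrame.syzygy_relations (fr : GMFrame D x) (hs : ∀ v w, D v w = D w v) (hx : D x x = 0)
    {n : Fin 5 → Fin c → ℂ} {n₅ : Fin c → ℂ} (hform : ∀ A C (u u' : ℂ),
      D (fr.τ A + u • fr.o) (fr.τ C + u' • fr.o) =
        ∑ k, pfaffPolar A C k • n k + (fr.κ * (u * u') + fr.q A C) • n₅)
    {S : (Fin c → ℂ) →ₗ[ℂ] (Fin m → ℂ)}
    (H : ∀ L : (Fin m → ℂ) →ₗ[ℂ] Module.Dual ℂ (Fin c → ℂ),
      (∀ w, D x w = 0 → L w (D w w) = 0) →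
      ∀ t, D x t = 0 → D t t = 0 → ∀ v, D x v = 0 → L t (D t (S (D v t))) = 0)
    {Λ : (Fin 10 → ℂ) →ₗ[ℂ] Module.Dual ℂ (Fin c → ℂ)}
    (hΛ : ∀ A (z : ℂ), Λ A (∑ k, pfaffPolar A A k • n k + z • n₅) = 0) :
    (∀ A, Λ A (D fr.o (S n₅)) = 0) ∧ ∀ a b C, ∑ k, pfaffPolar C (pluckerVec a b) k *
      Λ (pluckerVec a b) (D fr.o (S (n k))) = 0 := by
  obtain ⟨π, hπ⟩ := fr.exists_projection
  have hπ' : ∀ A (u : ℂ), π (fr.τ A + u • fr.o) = A := fun A u => by simpa using hπ 0 A u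
  have hL : ∀ w, D x w = 0 → (Λ.comp π) w (D w w) = 0 := fun w hw => by
    obtain ⟨s, A, u, rfl⟩ := fr.exists_eq w hw
    have h1 := fr.apply_eq_zero A u
    have h2 : ∀ t, D x t = 0 → D (s • x + t) (s • x + t) = D t t := fun t ht => by
      simp [ht, hs t x, hx]
    rw [LinearMap.comp_apply, hπ, h2 _ h1, hform, hΛ]
  have hiso : ∀ a b, ∃ u : ℂ, fr.κ * u ^ 2 = - fr.q (pluckerVec a b) (pluckerVec a b) ∧
      ∀ v, D x v = 0 →
      (Λ (pluckerVec a b) (D (fr.τ (pluckerVec a b) + u • fr.o)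
        (S (D v (fr.τ (pluckerVec a b) + u • fr.o)))) = 0 ∧
      Λ (pluckerVec a b) (D (fr.τ (pluckerVec a b) + (-u) • fr.o)
        (S (D v (fr.τ (pluckerVec a b) + (-u) • fr.o)))) = 0) := fun a b => by
    obtain ⟨u, hu⟩ := IsAlgClosed.exists_pow_nat_eq
      (- fr.q (pluckerVec a b) (pluckerVec a b) / fr.κ) two_pos
    have hu' : fr.κ * u ^ 2 = - fr.q (pluckerVec a b) (pluckerVec a b) := by
      rw [hu, mul_div_cancel₀ _ fr.κ_ne_zero]
    refine ⟨u, hu', fun v hv => ⟨?_, ?_⟩⟩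
    · have := H _ hL _ (fr.apply_eq_zero (pluckerVec a b) u)
        ((fr.isotropic_iff _ _).2 ⟨⟨a, b, rfl⟩, by rw [hu']; ring⟩) v hv
      rwa [LinearMap.comp_apply, hπ'] at this
    · have := H _ hL _ (fr.apply_eq_zero (pluckerVec a b) (-u))
        ((fr.isotropic_iff _ _).2 ⟨⟨a, b, rfl⟩, by rw [neg_sq, hu']; ring⟩) v hv
      rwa [LinearMap.comp_apply, hπ'] at this
  have hu0 : ∀ {a b} {u : ℂ}, fr.q (pluckerVec a b) (pluckerVec a b) ≠ 0 →
      fr.κ * u ^ 2 = - fr.q (pluckerVec a b) (pluckerVec a b) → u ≠ 0 := by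
    rintro a b u hq hu rfl
    exact hq (by simpa using hu.symm)
  have h₅ : ((LinearMap.applyₗ (D fr.o (S n₅))).comp Λ) = 0 :=
    linearMap_eq_zero_of_generic_pluckerVec fr.q_ne_zero fun a b hab => by
      obtain ⟨u, hu, h⟩ := hiso a b
      have hu' := hu0 hab hu
      obtain ⟨h1, h2⟩ := h fr.o (by simpa using fr.apply_eq_zero 0 1)
      have ho : ∀ u : ℂ, D fr.o (fr.τ (pluckerVec a b) + u • fr.o) = (fr.κ * u) • n₅ := fun u => by
        simpa using hform 0 (pluckerVec a b) 1 u
      simp only [ho, map_smul, map_add, LinearMap.add_apply, LinearMap.smul_apply,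
        smul_eq_mul] at h1 h2
      have h3 : (fr.κ * u ^ 2) * Λ (pluckerVec a b) (D fr.o (S n₅)) = 0 := by
        linear_combination (1 / 2 : ℂ) * h1 + (1 / 2 : ℂ) * h2
      simpa [fr.κ_ne_zero, hu'] using h3
  have h₅' : ∀ A, Λ A (D fr.o (S n₅)) = 0 := fun A => LinearMap.congr_fun h₅ A
  refine ⟨h₅', fun a b C => ?_⟩
  let β : (Fin 10 → ℂ) →ₗ[ℂ] (Fin 10 → ℂ) →ₗ[ℂ] ℂ :=
    LinearMap.mk₂ ℂ (fun A B => ∑ k, pfaffPolar C A k * Λ B (D fr.o (S (n k))))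
      (by intros; simp [add_mul, Finset.sum_add_distrib])
      (by intros; simp [Finset.mul_sum, mul_assoc])
      (by intros; simp [mul_add, Finset.sum_add_distrib])
      (by intros; simp [Finset.mul_sum, mul_left_comm])
  refine bilin_eq_zero_of_generic_pluckerVec (β := β) fr.q_ne_zero (fun a b hab => ?_) a b
  obtain ⟨u, hu, h⟩ := hiso a b
  have hu' := hu0 hab hu
  obtain ⟨h1, h2⟩ := h (fr.τ C) (by simpa using fr.apply_eq_zero C 0)
  have ho : ∀ u : ℂ, D (fr.τ C) (fr.τ (pluckerVec a b) + u • fr.o) =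
      ∑ k, pfaffPolar C (pluckerVec a b) k • n k + fr.q C (pluckerVec a b) • n₅ := fun u => by
    simpa using hform C (pluckerVec a b) 0 u
  rw [ho, map_add, LinearMap.add_apply] at h1 h2
  rw [map_smul, LinearMap.smul_apply] at h1 h2
  have h3 : u * Λ (pluckerVec a b) (D fr.o (S (∑ k, pfaffPolar C (pluckerVec a b) k • n k +
      fr.q C (pluckerVec a b) • n₅))) = 0 := by
    simp only [map_add (Λ (pluckerVec a b)) (D _ _), map_smul (Λ (pluckerVec a b)),
      smul_eq_mul] at h1 h2
    linear_combination (1 / 2 : ℂ) * h1 - (1 / 2 : ℂ) * h2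
  have h4 := (mul_eq_zero.1 h3).resolve_left hu'
  rw [LinearMap.mk₂_apply]
  simpa [h₅'] using h4

end GoodVector

section GoodVector

theorem exists_generalized_inverse {V K : Type*} [AddCommGroup V] [Module ℂ V] [AddCommGroup K]
    [Module ℂ K] (f : V →ₗ[ℂ] K) : ∃ S : K →ₗ[ℂ] V, ∀ w, f (S (f w)) = f w := by
  obtain ⟨g, hg⟩ := f.rangeRestrict.exists_rightInverse_of_surjective
    (LinearMap.range_eq_top.2 f.surjective_rangeRestrict)
  obtain ⟨S, hS⟩ := g.exists_extend
  refine ⟨S, fun w => ?_⟩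
  have h1 : S (f w) = g (f.rangeRestrict w) := LinearMap.congr_fun hS (f.rangeRestrict w)
  rw [h1]
  exact congrArg Subtype.val (LinearMap.congr_fun hg (f.rangeRestrict w))

variable {m c : ℕ} {D : (Fin m → ℂ) →ₗ[ℂ] (Fin m → ℂ) →ₗ[ℂ] (Fin c → ℂ)} {x : Fin m → ℂ}

/-- If all syzygies lift at `x`, some tangent vector `o` has `D o` of rank one with value
`D o o ≠ 0`. -/
theorem GMFrame.exists_rank_one_vector (fr : GMFrame D x) (hs : ∀ v w, D v w = D w v)
    (hx : D x x = 0)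
    (hrange : ∀ v w, D x v = 0 → D x w = 0 → D v w ∈ LinearMap.range (D x))
    (hrk : Module.finrank ℂ (LinearMap.range (D x)) = 6)
    (H : ∀ S : (Fin c → ℂ) →ₗ[ℂ] (Fin m → ℂ), (∀ w, D x (S (D x w)) = D x w) →
      ∀ L : (Fin m → ℂ) →ₗ[ℂ] Module.Dual ℂ (Fin c → ℂ),
      (∀ w, D x w = 0 → L w (D w w) = 0) →
      ∀ t, D x t = 0 → D t t = 0 → ∀ v, D x v = 0 → L t (D t (S (D v t))) = 0) :
    ∃ o, D o o ≠ 0 ∧ D x o = 0 ∧ ∀ w, ∃ r : ℂ, D o w = r • D o o := by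
  obtain ⟨n, n₅, hform, hn₅, hnr, hnr₅, hspan, ν, hν, hν₅⟩ := fr.exists_conormal_basis hs hrange hrk
  obtain ⟨S, hS⟩ := exists_generalized_inverse (D x)
  have hSr : ∀ y ∈ LinearMap.range (D x), D x (S y) = y := by
    rintro _ ⟨w, rfl⟩
    exact hS w
  have hrel := fun Λ hΛ => fr.syzygy_relations hs hx hform (H S hS) (Λ := Λ) hΛ
  have hann : ∀ b : Module.Dual ℂ (Fin c → ℂ), LinearMap.range (D x) ≤ LinearMap.ker b →
      b (D fr.o (S n₅)) = 0 ∧ ∀ k, b (D fr.o (S (n k))) = 0 := fun b hb => by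
    have h1 := fun j : Fin 10 => hrel ((LinearMap.toSpanSingleton ℂ _ b).comp (LinearMap.proj j))
      (fun A z => by
        have h2 : b (∑ k, pfaffPolar A A k • n k + z • n₅) = 0 :=
          hb (add_mem (sum_mem fun k _ => Submodule.smul_mem _ _ (hnr k))
            (Submodule.smul_mem _ _ hnr₅))
        simp only [LinearMap.comp_apply, LinearMap.toSpanSingleton_apply, LinearMap.smul_apply,
          h2, smul_zero])
    refine ⟨by simpa using (h1 0).1 (Pi.single 0 1), fun k => ?_⟩
    exact congrFun (eq_zero_of_sum_pfaffPolar_mul (M := fun k => b (D fr.o (S (n k))))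
      fun a b C j => (h1 j).2 a b C) k
  have hmem : ∀ y : Fin c → ℂ, (∀ b : Module.Dual ℂ (Fin c → ℂ),
      LinearMap.range (D x) ≤ LinearMap.ker b → b y = 0) → y ∈ LinearMap.range (D x) := by
    intro y h
    by_contra hy
    obtain ⟨b, hb, hb'⟩ := Submodule.exists_le_ker_of_notMem hy
    exact hb (h b hb')
  let Λ : Fin 5 → (Fin 10 → ℂ) →ₗ[ℂ] Module.Dual ℂ (Fin c → ℂ) := fun j =>
    ∑ i, (LinearMap.toSpanSingleton ℂ _ (ν i)).comp ((Matrix.entryLinearMap ℂ ℂ j i).comp skewMat)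
  have hΛ : ∀ j A y, Λ j A y = ∑ i, skewMat A j i * ν i y := fun j A y => by
    simp [Λ, LinearMap.sum_apply]
  have hν' : ∀ i (r : Fin 5 → ℂ) (z : ℂ), ν i (∑ k, r k • n k + z • n₅) = r i := fun i r z => by
    simp [hν, hν₅]
  have hrelΛ := fun j => hrel (Λ j) fun A z => by
    rw [hΛ, ← sum_skewMat_mul_pfaffPolar A j]
    exact Finset.sum_congr rfl fun i _ => by rw [hν']
  have hν₅' : ∀ i, ν i (D fr.o (S n₅)) = 0 := fun i => by
    obtain ⟨j, hj⟩ := exists_ne i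
    have h1 := (hrelΛ j).1 (pluckerVec (Pi.single j 1) (Pi.single i 1))
    simpa [hΛ, skewMat_pluckerVec, Pi.single_apply, hj] using h1
  obtain ⟨μ, hμ⟩ := exists_eq_smul_one_of_sum_pfaffPolar_mul
    (M := Matrix.of fun i k => ν i (D fr.o (S (n k)))) fun a b C j => by
      simpa only [hΛ, Matrix.of_apply] using (hrelΛ j).2 a b C
  have hμ' : ∀ i k, ν i (D fr.o (S (n k))) = if i = k then μ else 0 := fun i k => by
    simpa [Matrix.one_apply] using congrFun (congrFun hμ i) k
  have he₅ : ∃ z : ℂ, D fr.o (S n₅) = z • n₅ := by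
    obtain ⟨r, z, h1⟩ := hspan _ (hmem _ fun b hb => (hann b hb).1)
    have hr : r = 0 := funext fun i => by rw [← hν' i r z, ← h1, hν₅', Pi.zero_apply]
    exact ⟨z, by simpa [hr] using h1⟩
  have he : ∀ k, ∃ z : ℂ, D fr.o (S (n k)) = μ • n k + z • n₅ := fun k => by
    obtain ⟨r, z, h1⟩ := hspan _ (hmem _ fun b hb => (hann b hb).2 k)
    have hr : ∀ i, r i = if i = k then μ else 0 := fun i => by rw [← hν' i r z, ← h1, hμ']
    exact ⟨z, by simpa [hr] using h1⟩
  have hxo : D x fr.o = 0 := by simpa using fr.apply_eq_zero 0 1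
  have hoo : D fr.o fr.o = fr.κ • n₅ := by simpa using hform 0 0 1 1
  have key : ∀ w, ∃ r : ℂ, D (fr.o - μ • x) w = r • n₅ := by
    intro w
    let W : Submodule ℂ (Fin m → ℂ) := (Submodule.span ℂ {n₅}).comap (D (fr.o - μ • x))
    have hW : ∀ w, w ∈ W ↔ ∃ r : ℂ, D (fr.o - μ • x) w = r • n₅ := fun w => by
      simp [W, Submodule.mem_span_singleton, eq_comm]
    have hW₅ : S n₅ ∈ W := by
      obtain ⟨z, hz⟩ := he₅
      refine (hW _).2 ⟨z - μ, ?_⟩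
      rw [map_sub, map_smul, LinearMap.sub_apply, LinearMap.smul_apply, hz, hSr _ hnr₅, sub_smul]
    have hWn : ∀ k, S (n k) ∈ W := fun k => by
      obtain ⟨z, hz⟩ := he k
      refine (hW _).2 ⟨z, ?_⟩
      rw [map_sub, map_smul, LinearMap.sub_apply, LinearMap.smul_apply, hz, hSr _ (hnr k),
        add_sub_cancel_left]
    have hWker : ∀ v, D x v = 0 → v ∈ W := fun v hv => by
      obtain ⟨s, A, u, rfl⟩ := fr.exists_eq v hv
      refine (hW _).2 ⟨fr.κ * u, ?_⟩
      have h1 : D fr.o (fr.τ A + u • fr.o) = (fr.κ * u) • n₅ := by simpa using hform 0 A 1 u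
      rw [map_sub, map_smul, LinearMap.sub_apply, LinearMap.smul_apply, hv, map_add, h1, map_smul,
        hs, hxo]
      simp
    rw [← hW]
    obtain ⟨r, z, h1⟩ := hspan (D x w) ⟨w, rfl⟩
    have h2 : w - (∑ k, r k • S (n k) + z • S n₅) ∈ W := hWker _ (by
      simp only [map_sub, map_add, map_sum, map_smul, hSr _ hnr₅, hSr _ (hnr _), ← h1, sub_self])
    exact (Submodule.sub_mem_iff_left _ (add_mem
      (sum_mem fun k _ => W.smul_mem _ (hWn k)) (W.smul_mem _ hW₅))).1 h2
  have hval : D (fr.o - μ • x) (fr.o - μ • x) = fr.κ • n₅ := by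
    simp [hs fr.o x, hxo, hx, hoo]
  refine ⟨fr.o - μ • x, ?_, by simp [hxo, hx], fun w => ?_⟩
  · rw [hval]
    exact smul_ne_zero fr.κ_ne_zero hn₅
  · obtain ⟨r, hr⟩ := key w
    exact ⟨r * fr.κ⁻¹, by rw [hval, hr, smul_smul, inv_mul_cancel_right₀ fr.κ_ne_zero]⟩

end GoodVector

section ZariskiTopology

variable {m : ℕ}

theorem not_pvanish_mul {p q : MvPolynomial (Fin m) ℂ} {x : PS m} (hp : ¬ PVanish p x)
    (hq : ¬ PVanish q x) : ¬ PVanish (p * q) x := by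
  let ρ : MvPolynomial (Fin m) ℂ →ₐ[ℂ] Polynomial ℂ :=
    MvPolynomial.aeval fun i => Polynomial.C (x.rep i) * Polynomial.X
  have hρ : ∀ p t, (ρ p).eval t = MvPolynomial.eval (t • x.rep) p := fun p t => by
    induction p using MvPolynomial.induction_on with
    | C a => rw [MvPolynomial.algHom_C, MvPolynomial.eval_C]; exact Polynomial.eval_C
    | add p q hp hq => rw [map_add, Polynomial.eval_add, hp, hq, map_add]
    | mul_X p i hp =>
      rw [map_mul, Polynomial.eval_mul, hp, map_mul, MvPolynomial.eval_X, MvPolynomial.aeval_X,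
        Polynomial.eval_mul, Polynomial.eval_C, Polynomial.eval_X, Pi.smul_apply, smul_eq_mul,
        mul_comm t]
  have hne : ∀ p, ¬ PVanish p x → ρ p ≠ 0 := fun p hp h0 =>
    hp (pvanish_of_forall_smul fun t => by rw [← hρ, h0, Polynomial.eval_zero])
  intro h
  refine mul_ne_zero (hne p hp) (hne q hq) (Polynomial.funext fun t => ?_)
  rw [← map_mul, hρ, Polynomial.eval_zero]
  exact h _ (Submodule.smul_mem _ t (rep_mem_submodule x))

theorem PaperQV.ZClosed.union {C₁ C₂ : Set (PS m)} (h₁ : ZClosed C₁) (h₂ : ZClosed C₂) :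
    ZClosed (C₁ ∪ C₂) := by
  obtain ⟨P, rfl⟩ := h₁
  obtain ⟨Q, rfl⟩ := h₂
  refine ⟨{r | ∃ p ∈ P, ∃ q ∈ Q, r = p * q}, Set.ext fun x => ⟨?_, fun h => ?_⟩⟩
  · rintro (h | h) _ ⟨p, hp, q, hq, rfl⟩ v hv
    · rw [map_mul, h p hp v hv, zero_mul]
    · rw [map_mul, h q hq v hv, mul_zero]
  · by_contra hx
    simp only [Set.mem_union, not_or, ZeroLocus, Set.mem_ofPred_eq, not_forall] at hx
    obtain ⟨⟨p, hp, hp'⟩, q, hq, hq'⟩ := hx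
    exact not_pvanish_mul hp' hq' (h _ ⟨p, hp, q, hq, rfl⟩)

theorem PaperQV.ZIrreducible.subset_or_exists_of_subset_biUnion {X : Set (PS m)}
    (hX : ZIrreducible X) {ι : Type*} (s : Finset ι) {C : ι → Set (PS m)}
    (hC : ∀ i ∈ s, ZClosed (C i)) {C₀ : Set (PS m)} (hC₀ : ZClosed C₀)
    (h : ∀ x ∈ X, x ∉ C₀ → ∃ i ∈ s, x ∈ C i) : X ⊆ C₀ ∨ ∃ i ∈ s, X ⊆ C i := by
  classical
  induction s using Finset.induction_on generalizing C₀ with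
  | empty =>
    refine Or.inl fun x hx => ?_
    by_contra hx'
    obtain ⟨i, hi, -⟩ := h x hx hx'
    simp at hi
  | insert a s _ ih =>
    have ha := hC a (Finset.mem_insert_self a s)
    rcases ih (fun i hi => hC i (Finset.mem_insert_of_mem hi)) (hC₀.union ha) (fun x hx hx' => by
      rw [Set.mem_union, not_or] at hx'
      obtain ⟨i, hi, hxi⟩ := h x hx hx'.1
      rcases Finset.mem_insert.1 hi with rfl | hi
      · exact absurd hxi hx'.2
      · exact ⟨i, hi, hxi⟩) with h1 | ⟨i, hi, h1⟩
    · rcases hX.2 _ _ hC₀ ha h1 with h2 | h2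
      · exact Or.inl h2
      · exact Or.inr ⟨a, Finset.mem_insert_self a s, h2⟩
    · exact Or.inr ⟨i, Finset.mem_insert_of_mem hi, h1⟩

theorem zClosed_linearMap_eq_zero {c : ℕ} (f : (Fin m → ℂ) →ₗ[ℂ] (Fin c → ℂ)) :
    ZClosed {x : PS m | f x.rep = 0} := by
  refine ⟨Set.range fun k => ∑ i, MvPolynomial.C (f (Pi.single i 1) k) * MvPolynomial.X i,
    Set.ext fun x => ?_⟩
  have hf : ∀ v k, MvPolynomial.eval v
      (∑ i, MvPolynomial.C (f (Pi.single i 1) k) * MvPolynomial.X i) = f v k := fun v k => by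
    conv_rhs => rw [← (Pi.basisFun ℂ (Fin m)).sum_repr v]
    simp [mul_comm]
  constructor
  · rintro h _ ⟨k, rfl⟩
    refine pvanish_of_forall_smul fun t => ?_
    rw [hf, map_smul, (h : f x.rep = 0), smul_zero, Pi.zero_apply]
  · intro h
    refine funext fun k => ?_
    rw [← hf]
    exact h _ ⟨k, rfl⟩ _ (rep_mem_submodule x)

end ZariskiTopology

section RankOneVectors

variable {m c : ℕ} {X : Set (PS m)} {D : (Fin m → ℂ) →ₗ[ℂ] (Fin m → ℂ) →ₗ[ℂ] (Fin c → ℂ)}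

theorem apply_eq_zero_of_rank_one (hs : ∀ v w, D v w = D w v)
    (hlt : ∀ v, v ≠ 0 → D v v = 0 → 1 < Module.finrank ℂ (LinearMap.range (D v)))
    {o₁ o₂ : Fin m → ℂ} (h₁ : ∀ w, ∃ r : ℂ, D o₁ w = r • D o₁ o₁)
    (h₂ : ∀ w, ∃ r : ℂ, D o₂ w = r • D o₂ o₂)
    (hind : ∀ r : ℂ, o₂ ≠ r • o₁) : D o₁ o₂ = 0 := by
  by_contra hne
  obtain ⟨r, hr⟩ := h₁ o₂
  obtain ⟨s, hs'⟩ := h₂ o₁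
  rw [hs] at hs'
  have hs0 : s ≠ 0 := by
    rintro rfl
    exact hne (by rw [hs', zero_smul])
  have h22 : D o₂ o₂ = (s⁻¹ * r) • D o₁ o₁ := by
    rw [mul_smul, ← hr, hs', smul_smul, inv_mul_cancel₀ hs0, one_smul]
  obtain ⟨d, hd⟩ := IsAlgClosed.exists_pow_nat_eq (r ^ 2 - s⁻¹ * r) two_pos
  have hv0 : o₂ + (d - r) • o₁ ≠ 0 := fun h => hind (-(d - r)) (by
    rw [neg_smul]
    exact eq_neg_of_add_eq_zero_left h)
  have hvv : D (o₂ + (d - r) • o₁) (o₂ + (d - r) • o₁) = 0 := by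
    simp only [map_add, map_smul, LinearMap.add_apply, LinearMap.smul_apply, hs o₂ o₁, hr, h22,
      smul_smul, ← add_smul]
    refine smul_eq_zero_of_left ?_ _
    linear_combination hd
  refine (hlt _ hv0 hvv).not_ge ((Submodule.finrank_mono ?_).trans
    (finrank_span_singleton (K := ℂ) (v := D o₁ o₁) ?_).le)
  · rintro _ ⟨w, rfl⟩
    obtain ⟨a, ha⟩ := h₁ w
    obtain ⟨b, hb⟩ := h₂ w
    rw [map_add, map_smul, LinearMap.add_apply, LinearMap.smul_apply, ha, hb, h22]
    have := Submodule.mem_span_singleton_self (R := ℂ) (D o₁ o₁)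
    exact add_mem (Submodule.smul_mem _ _ (Submodule.smul_mem _ _ this))
      (Submodule.smul_mem _ _ (Submodule.smul_mem _ _ this))
  · intro h0
    exact hne (by rw [hr, h0, smul_zero])

theorem exists_finset_rank_one (hs : ∀ v w, D v w = D w v)
    (hlt : ∀ v, v ≠ 0 → D v v = 0 → 1 < Module.finrank ℂ (LinearMap.range (D v))) :
    ∃ B : Finset (Fin m → ℂ), (∀ b ∈ B, D b b ≠ 0) ∧ ∀ o, D o o ≠ 0 →
      (∀ w, ∃ r : ℂ, D o w = r • D o o) → ∃ b ∈ B, ∃ r : ℂ, r ≠ 0 ∧ o = r • b := by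
  obtain ⟨B, hBsub, hspan, hli⟩ := exists_linearIndependent ℂ
    {o : Fin m → ℂ | D o o ≠ 0 ∧ ∀ w, ∃ r : ℂ, D o w = r • D o o}
  have hfin : B.Finite := hli.setFinite
  refine ⟨hfin.toFinset, fun b hb => (hBsub (hfin.mem_toFinset.1 hb)).1, fun o ho ho' => ?_⟩
  by_contra! hno
  have hz : ∀ b ∈ B, D b o = 0 := fun b hb =>
    apply_eq_zero_of_rank_one hs hlt (hBsub hb).2 ho' fun r hr => by
      refine hno b (hfin.mem_toFinset.2 hb) r ?_ hr
      rintro rfl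
      exact ho (by simp [hr])
  have hle : Submodule.span ℂ B ≤ LinearMap.ker (D o) :=
    Submodule.span_le.2 fun b hb => by
      rw [SetLike.mem_coe, LinearMap.mem_ker, hs]
      exact hz b hb
  exact ho (hle (hspan ▸ Submodule.subset_span ⟨ho, ho'⟩))

end RankOneVectors

/-- No smooth quadratic eleven-fold in `ℙ¹⁷` has Gushel–Mukai sixfolds as its varieties of lines
through general points. -/
theorem not_genericallyOn_isVMRTModel (X : Set (PS 18))
    (hsm : SmoothVariety X 11) (hnd : Nondegenerate X) (hq : IsQuadratic X)
    (hvmrt : GenericallyOn X (fun x => ∃ W : Set (PS 11), IsVMRTModel X x W ∧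
      ∃ G : Set (PS 11), IsGushelMukai6 G ∧ ProjEquiv W G)) : False := by
  obtain ⟨-, hirr, -, hdim⟩ := hsm
  obtain ⟨c, D, hs, hX, htan⟩ := hq.exists_system
  have hrk : ∀ x ∈ X, Module.finrank ℂ (LinearMap.range (D x.rep)) = 6 := fun x hx => by
    have h1 := LinearMap.finrank_range_add_finrank_ker (D x.rep)
    rw [← htan x hx, hdim x hx, Module.finrank_fin_fun] at h1
    omega
  have hlt : ∀ v, v ≠ 0 → D v v = 0 → 1 < Module.finrank ℂ (LinearMap.range (D v)) := by
    intro v hv hvv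
    have h1 := hrk _ ((mk_mem_iff_of_system hX hv).2 hvv)
    obtain ⟨a, ha⟩ := Projectivization.exists_smul_eq_mk_rep ℂ v hv
    rw [← ha, Units.smul_def, map_smul, LinearMap.range_smul _ _ a.ne_zero] at h1
    omega
  obtain ⟨B, hB, hBo⟩ := exists_finset_rank_one hs hlt
  obtain ⟨C₁, hC₁, hXC₁, h₁⟩ := hvmrt
  obtain ⟨C₂, hC₂, hXC₂, h₂⟩ := genericallyOn_syzygy_lift hirr hs htan
  have hcover : ∀ x ∈ X, x ∉ C₁ ∪ C₂ → ∃ b ∈ B, x ∈ {x : PS 18 | D b x.rep = 0} := by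
    intro x hx hxC
    rw [Set.mem_union, not_or] at hxC
    obtain ⟨W, hW, G, hG, hWG⟩ := h₁ x ⟨hx, hxC.1⟩
    obtain ⟨fr⟩ := hW.nonempty_gmFrame hs hX hx (htan x hx) hG hWG
    obtain ⟨o, ho, hxo, ho'⟩ := fr.exists_rank_one_vector hs ((hX x).1 hx)
      (fun v w hv hw => mem_range_of_mem_tangent htan hdim hx hv hw) (hrk x hx)
      (h₂ x ⟨hx, hxC.2⟩)
    obtain ⟨b, hb, r, hr, rfl⟩ := hBo o ho ho'
    refine ⟨b, hb, ?_⟩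
    rw [map_smul] at hxo
    rw [Set.mem_ofPred_eq, hs]
    exact (smul_eq_zero.1 hxo).resolve_left hr
  rcases hirr.subset_or_exists_of_subset_biUnion B (fun b _ => zClosed_linearMap_eq_zero (D b))
    (hC₁.union hC₂) hcover with h | ⟨b, hb, h⟩
  · exact (hirr.2 _ _ hC₁ hC₂ h).elim hXC₁ hXC₂
  · refine hB b hb (funext fun k => ?_)
    have h0 := hnd ((LinearMap.proj k).comp (D b)) fun x hx v hv => by
      rw [Projectivization.submodule_eq] at hv
      obtain ⟨a, rfl⟩ := Submodule.mem_span_singleton.1 hv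
      have h1 : D b x.rep = 0 := h hx
      simp [h1]
    exact LinearMap.congr_fun h0 b

/-- **Lemma 5.4.** The hypothetical variety `X ⊆ ℙ¹⁷` of Theorem 1.2 (iv)
admits no double cover onto a smooth quadratic variety `Y ⊆ ℙ¹⁶`. -/
theorem no_double_cover (𝒢 : GeomInterp) (X : Set (PS 18))
    (hsm : SmoothVariety X 11) (hnd : Nondegenerate X) (hq : IsQuadratic X)
    (hF : 𝒢.IsFanoVariety X) (hidx : 𝒢.fanoIndex X = 8)
    (hlines : CoveredByLines X)
    (hvmrt : GenericallyOn X (fun x => ∃ W : Set (PS 11), IsVMRTModel X x W ∧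
      ∃ G : Set (PS 11), IsGushelMukai6 G ∧ ProjEquiv W G)) :
    ¬ ∃ (Y : Set (PS 17)) (f : PS 18 → PS 17) (nY : ℕ),
      SmoothVariety Y nY ∧ IsQuadratic Y ∧ IsDoubleCover X Y f := by
  exact fun _ => not_genericallyOn_isVMRTModel X hsm hnd hq hvmrt
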